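/- arXiv:0808.3344 — 3 statements merged into one kernel-verified Lean document; each statement's English description precedes it below -/
import Mathlib

section
/- Let d ≥ 3. There is a constant c > 0 depending only on d such that for every integer L ≥ 2 and every y ∈ ℤ^d the following holds. Let C = (y + [0, L]²×{0}^{d−2}) ∩ ℤ^d be a square of side L in the e_1–e_2 plane, and for 0 ≤ j < L let I_j = (y + {j}×[0, L]×{0}^{d−2}) ∩ ℤ^d be its j-th vertical segment. Then sup_{x ∈ C} E_x[ Σ_{0 ≤ j < L} 1_{H_{I_j} < ∞} ] ≤ c·L / log L. -/
open MeasureTheory Filter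

namespace RI

/-- Points of `ℤ^d`. -/
abbrev Zd (d : ℕ) := Fin d → ℤ

/-- `x` and `y` are nearest neighbours: `|x - y| = 1`. -/
def adj {d : ℕ} (x y : Zd d) : Prop := (∑ i, |x i - y i|) = 1

/-- `x` and `y` are `*`-neighbours: `|x - y|_∞ = 1`. -/
def starAdj {d : ℕ} (x y : Zd d) : Prop := x ≠ y ∧ ∀ i, |x i - y i| ≤ 1

/-- `x` belongs to the plane `ℤ e₁ + ℤ e₂ ⊆ ℤ^d`. -/
def inPlane {d : ℕ} (x : Zd d) : Prop := ∀ i : Fin d, 2 ≤ (i : ℕ) → x i = 0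

/-- The `k`-th coordinate of `x`, with value `0` for out-of-range indices. -/
def coord {d : ℕ} (x : Zd d) (k : ℕ) : ℤ := if h : k < d then x ⟨k, h⟩ else 0

/-- `P` is the family of laws of the simple random walks on `ℤ^d` started at the points of
`ℤ^d`: each `P x` is a probability measure on the path space `ℕ → ℤ^d`, and the cylinder
probabilities are those of the walk with i.i.d. increments uniform on `{± e_i}`. -/
def IsSRW (d : ℕ) (P : Zd d → Measure (ℕ → Zd d)) : Prop :=
  (∀ x, IsProbabilityMeasure (P x)) ∧
  (∀ (x : Zd d) (n : ℕ) (w : ℕ → Zd d),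
      (w 0 = x ∧ ∀ k < n, adj (w k) (w (k + 1))) →
        P x {ω | ∀ k ≤ n, ω k = w k} = ((2 * d : ENNReal))⁻¹ ^ n) ∧
  (∀ (x : Zd d) (n : ℕ) (w : ℕ → Zd d),
      ¬(w 0 = x ∧ ∀ k < n, adj (w k) (w (k + 1))) →
        P x {ω | ∀ k ≤ n, ω k = w k} = 0)

/-- The equilibrium measure of a set `V ⊆ ℤ^d`:
`e_V(x) = P_x[H̃_V = ∞]` for `x ∈ V`, and `0` otherwise. -/
noncomputable def eqm {d : ℕ} (P : Zd d → Measure (ℕ → Zd d)) (V : Set (Zd d)) : Zd d → ℝ :=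
  V.indicator fun x => (P x {ω | ∀ n, 1 ≤ n → ω n ∉ V}).toReal

/-- The capacity of a finite set `K ⊆ ℤ^d`. -/
noncomputable def capa {d : ℕ} (P : Zd d → Measure (ℕ → Zd d)) (K : Finset (Zd d)) : ℝ :=
  ∑ x ∈ K, eqm P (↑K) x

/-- `Q` is a vacant-set law at level `u`: a probability measure on `{0,1}^{ℤ^d}`
(with `true = 1` standing for "vacant") such that
`Q[Y_x = 1 ∀ x ∈ K] = exp(-u cap K)` for every finite `K`. -/
def IsVacantLaw {d : ℕ} (P : Zd d → Measure (ℕ → Zd d)) (u : ℝ)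
    (Q : Measure (Zd d → Bool)) : Prop :=
  IsProbabilityMeasure Q ∧
  ∀ K : Finset (Zd d),
    Q {Y | ∀ x ∈ K, Y x = true} = ENNReal.ofReal (Real.exp (-(u * capa P K)))

/-- There is a `*`-path starting in `S`, ending in `T`, all of whose points lie in `A`. -/
def HasStarPath {d : ℕ} (S T A : Set (Zd d)) : Prop :=
  ∃ (N : ℕ) (w : ℕ → Zd d), w 0 ∈ S ∧ w N ∈ T ∧ (∀ k ≤ N, w k ∈ A) ∧
    ∀ k < N, starAdj (w k) (w (k + 1))

/-- Interior boundary `∂_int U`. -/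
def intBdry {d : ℕ} (U : Set (Zd d)) : Set (Zd d) := {x | x ∈ U ∧ ∃ y, y ∉ U ∧ adj x y}

/-- (Exterior) boundary `∂U`. -/
def bdry {d : ℕ} (U : Set (Zd d)) : Set (Zd d) := {x | x ∉ U ∧ ∃ y ∈ U, adj x y}

/-- `ℓ = 100 ⌊L^{1/100}⌋ + 1`. -/
noncomputable def ellOf (L : ℕ) : ℕ := 100 * ⌊(L : ℝ) ^ ((1 : ℝ) / 100)⌋₊ + 1

/-- The scales `L_{n+1} = ℓ_n L_n`. -/
noncomputable def Lseq (L0 : ℕ) : ℕ → ℕ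
  | 0 => L0
  | n + 1 => ellOf (Lseq L0 n) * Lseq L0 n

/-- The levels `u_{n+1} = (1 + 1/log L_n)⁻¹ u_n`. -/
noncomputable def useq (L0 : ℕ) (u0 : ℝ) : ℕ → ℝ
  | 0 => u0
  | n + 1 => (1 + 1 / Real.log (Lseq L0 n))⁻¹ * useq L0 u0 n

/-- The event (on the configuration space `{0,1}^{ℤ^d}`) that there is a `*`-path from
`[-L,L]² ∩ ℤ²` to `∂_int ([-3L,3L]^d ∩ ℤ^d)` all of whose points lie in `{x ∈ ℤ² : Y_x = 0}`. -/
def qEvent (d : ℕ) (L : ℕ) : Set (Zd d → Bool) :=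
  {Y | HasStarPath
    {x : Zd d | inPlane x ∧ ∀ i, |x i| ≤ (L : ℤ)}
    (intBdry {x : Zd d | ∀ i, |x i| ≤ (3 * L : ℤ)})
    {x : Zd d | inPlane x ∧ Y x = false}}


end RI

open RI MeasureTheory Filter

lemma inv_sqrt_one_add_le {u : ℝ} (hu : |u| ≤ 1 / 4) :
    (√(1 + u))⁻¹ ≤ 1 - u / 2 + 3 * u ^ 2 / 8 - 5 * u ^ 3 / 16 + u ^ 4 := by
  obtain ⟨h1, h2⟩ := abs_le.mp hu
  have hpos : 0 < 1 + u := by linarith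
  have hu2 : u ^ 2 ≤ 1 / 16 := by nlinarith
  have hp : 0 < 1 - u / 2 + 3 * u ^ 2 / 8 - 5 * u ^ 3 / 16 + u ^ 4 := by
    nlinarith [sq_nonneg u, sq_nonneg (u ^ 2)]
  have key : 1 ≤ (1 - u / 2 + 3 * u ^ 2 / 8 - 5 * u ^ 3 / 16 + u ^ 4) ^ 2 * (1 + u) := by
    have hq : 0 ≤ 93 / 64 + u * (39 / 32) - u ^ 2 * (99 / 256) + u ^ 3 * (57 / 256)
        + u ^ 4 * (3 / 8) + u ^ 5 := by
      have h3 : |u ^ 3| ≤ 1 := by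
        rw [abs_pow]; exact pow_le_one₀ (abs_nonneg u) (by linarith)
      have h5 : |u ^ 5| ≤ 1 / 4 := by
        rw [abs_pow]
        calc |u| ^ 5 ≤ (1 / 4) ^ 5 := by gcongr
          _ ≤ 1 / 4 := by norm_num
      have := neg_abs_le (u ^ 3)
      have := neg_abs_le (u ^ 5)
      have : 0 ≤ u ^ 4 := by positivity
      linarith
    have := mul_nonneg (show 0 ≤ u ^ 4 by positivity) hq
    linear_combination this
  rw [inv_le_iff_one_le_mul₀ (Real.sqrt_pos.mpr hpos)]
  have h := Real.sqrt_le_sqrt key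
  rwa [Real.sqrt_one, Real.sqrt_mul (sq_nonneg _), Real.sqrt_sq hp.le] at h

lemma inv_sqrt_shift_add_le {s a : ℝ} (hs : 100 ≤ s) (ha : a ^ 2 ≤ s) :
    (√(s + 1 + 2 * a))⁻¹ + (√(s + 1 - 2 * a))⁻¹ ≤
      (√s)⁻¹ * (2 - 1 / s + (3 * a ^ 2 + 100) / s ^ 2) := by
  have hs0 : 0 < s := by linarith
  have hone : ∀ b : ℝ, b ^ 2 ≤ s → |(1 + 2 * b) / s| ≤ 1 / 4 := by
    intro b hb
    rw [abs_div, abs_of_pos hs0, div_le_iff₀ hs0]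
    have : |b| ≤ s / 10 := abs_le_of_sq_le_sq (by nlinarith) (by linarith)
    obtain ⟨h1, h2⟩ := abs_le.mp this
    rw [abs_le]
    constructor <;> linarith
  have hsplit : ∀ b : ℝ, b ^ 2 ≤ s → (√(s + 1 + 2 * b))⁻¹ ≤ (√s)⁻¹ *
      (1 - ((1 + 2 * b) / s) / 2 + 3 * ((1 + 2 * b) / s) ^ 2 / 8
        - 5 * ((1 + 2 * b) / s) ^ 3 / 16 + ((1 + 2 * b) / s) ^ 4) := by
    intro b hb
    have : s + 1 + 2 * b = s * (1 + (1 + 2 * b) / s) := by field_simp; ring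
    rw [this, Real.sqrt_mul hs0.le, mul_inv]
    gcongr
    exact inv_sqrt_one_add_le (hone b hb)
  have h1 := hsplit a ha
  have h2 := hsplit (-a) (by simpa using ha)
  rw [show s + 1 + 2 * -a = s + 1 - 2 * a by ring] at h2
  refine (add_le_add h1 h2).trans ?_
  rw [← mul_add]
  refine mul_le_mul_of_nonneg_left ?_ (by positivity)
  have hr : (0 : ℝ) < 1 / s := by positivity
  have hr' : 1 / s ≤ 1 / 100 := one_div_le_one_div_of_le (by norm_num) hs
  have hv : a ^ 2 * (1 / s) ≤ 1 := by rw [mul_one_div, div_le_one hs0]; exact ha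
  have hd1 : ∀ t : ℝ, t / s = t * (1 / s) := fun t => div_eq_mul_one_div t s
  have hd2 : ∀ t : ℝ, t / s ^ 2 = t * (1 / s) ^ 2 := fun t => by
    rw [div_eq_mul_one_div, one_div_pow]
  rw [hd1 (1 + 2 * a), hd1 (1 + 2 * -a), hd2]
  generalize 1 / s = r at *
  have hv2 : (a ^ 2 * r) ^ 2 ≤ 1 := pow_le_one₀ (by positivity) hv
  have hrr : r ^ 2 ≤ 1 / 100 := by nlinarith
  have hb1 : 48 * (a ^ 2 * r) * r ≤ 1 := by nlinarith [mul_nonneg (sq_nonneg a) hr.le]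
  have hb0 : 0 ≤ a ^ 2 * r := by positivity
  have hid : (1 - (1 + 2 * a) * r / 2 + 3 * ((1 + 2 * a) * r) ^ 2 / 8
        - 5 * ((1 + 2 * a) * r) ^ 3 / 16 + ((1 + 2 * a) * r) ^ 4) +
      (1 - (1 + 2 * -a) * r / 2 + 3 * ((1 + 2 * -a) * r) ^ 2 / 8
        - 5 * ((1 + 2 * -a) * r) ^ 3 / 16 + ((1 + 2 * -a) * r) ^ 4) =
      2 - r + r ^ 2 * (3 * a ^ 2 + 3 / 4 - 5 / 8 * r - 15 / 2 * (a ^ 2 * r)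
        + 2 * r ^ 2 + 48 * (a ^ 2 * r) * r + 32 * (a ^ 2 * r) ^ 2) := by ring
  have hle : 3 * a ^ 2 + 3 / 4 - 5 / 8 * r - 15 / 2 * (a ^ 2 * r)
        + 2 * r ^ 2 + 48 * (a ^ 2 * r) * r + 32 * (a ^ 2 * r) ^ 2 ≤ 3 * a ^ 2 + 100 := by
    linarith
  have := mul_le_mul_of_nonneg_left hle (sq_nonneg r)
  linarith

/-- A regularized Newtonian kernel in the coordinates of `S`, centered at `c`. -/
noncomputable def newtonKernel {d : ℕ} (S : Finset (Fin d)) (c z : Zd d) : ℝ :=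
  (√(100 + ∑ i ∈ S, ((z i - c i : ℤ) : ℝ) ^ 2))⁻¹

lemma newtonKernel_nonneg {d : ℕ} (S : Finset (Fin d)) (c z : Zd d) :
    0 ≤ newtonKernel S c z := by
  unfold newtonKernel; positivity

lemma sum_sq_add_single {d : ℕ} (S : Finset (Fin d)) (c z : Zd d) (i : Fin d) (t : ℤ) :
    ∑ k ∈ S, (((z + Pi.single i t : Zd d) k - c k : ℤ) : ℝ) ^ 2 =
      ∑ k ∈ S, ((z k - c k : ℤ) : ℝ) ^ 2 +
        if i ∈ S then (t : ℝ) ^ 2 + 2 * t * ((z i - c i : ℤ) : ℝ) else 0 := by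
  have h : ∀ k, (((z + Pi.single i t : Zd d) k - c k : ℤ) : ℝ) ^ 2 = ((z k - c k : ℤ) : ℝ) ^ 2 +
      if i = k then (t : ℝ) ^ 2 + 2 * t * ((z i - c i : ℤ) : ℝ) else 0 := by
    intro k
    by_cases hk : i = k
    · subst hk
      simp only [Pi.add_apply, Pi.single_eq_same, if_true]
      push_cast; ring
    · simp [hk]
  simp only [h, Finset.sum_add_distrib, Finset.sum_ite_eq]

lemma newtonKernel_superharmonic {d : ℕ} (S : Finset (Fin d)) (hS : S.card = 3) (c z : Zd d) :
    ∑ i, (newtonKernel S c (z + Pi.single i 1) + newtonKernel S c (z + Pi.single i (-1))) ≤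
      2 * d * newtonKernel S c z := by
  set s : ℝ := 100 + ∑ i ∈ S, ((z i - c i : ℤ) : ℝ) ^ 2 with hs
  have hsum : 0 ≤ ∑ i ∈ S, ((z i - c i : ℤ) : ℝ) ^ 2 := Finset.sum_nonneg fun i _ => sq_nonneg _
  have hs100 : 100 ≤ s := by linarith
  have hs0 : 0 < s := by linarith
  have hz : newtonKernel S c z = (√s)⁻¹ := rfl
  have hi : ∀ i, newtonKernel S c (z + Pi.single i 1) + newtonKernel S c (z + Pi.single i (-1)) ≤
      (√s)⁻¹ * (2 + if i ∈ S then -1 / s + (3 * ((z i - c i : ℤ) : ℝ) ^ 2 + 100) / s ^ 2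
        else 0) := by
    intro i
    unfold newtonKernel
    rw [sum_sq_add_single, sum_sq_add_single]
    by_cases h : i ∈ S
    · simp only [h, if_true]
      have ha : ((z i - c i : ℤ) : ℝ) ^ 2 ≤ s := by
        have := Finset.single_le_sum (f := fun i => ((z i - c i : ℤ) : ℝ) ^ 2)
          (fun i _ => sq_nonneg _) h
        linarith
      convert inv_sqrt_shift_add_le hs100 ha using 2
      · congr 2; rw [hs]; push_cast; ring
      · congr 2; rw [hs]; push_cast; ring
      · ring
    · simp only [h, if_false, add_zero, ← hs]
      linarith
  refine (Finset.sum_le_sum fun i _ => hi i).trans ?_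
  rw [← Finset.mul_sum, Finset.sum_add_distrib, Finset.sum_ite_mem, Finset.univ_inter,
    Finset.sum_add_distrib, ← Finset.sum_div S (fun i => 3 * ((z i - c i : ℤ) : ℝ) ^ 2 + 100),
    Finset.sum_add_distrib, ← Finset.mul_sum]
  simp only [Finset.sum_const, hS, Finset.card_univ, Fintype.card_fin, nsmul_eq_mul]
  rw [hz, mul_comm (2 * (d : ℝ))]
  gcongr
  have : ∑ i ∈ S, ((z i - c i : ℤ) : ℝ) ^ 2 = s - 100 := by rw [hs]; ring
  rw [this]
  have : ((3 : ℕ) : ℝ) * (-1 / s) + (3 * (s - 100) + ((3 : ℕ) : ℝ) * 100) / s ^ 2 = 0 := by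
    field_simp; push_cast; ring
  linarith

lemma exists_single_of_adj {d : ℕ} {z v : Zd d} (h : adj z v) :
    ∃ i, v = z + Pi.single i 1 ∨ v = z + Pi.single i (-1) := by
  unfold adj at h
  obtain ⟨i, -, hi⟩ : ∃ i ∈ Finset.univ, |z i - v i| ≠ 0 := by
    apply Finset.exists_ne_zero_of_sum_ne_zero
    omega
  rw [← Finset.add_sum_erase _ _ (Finset.mem_univ i)] at h
  have h0 : 0 ≤ ∑ k ∈ Finset.univ.erase i, |z k - v k| :=
    Finset.sum_nonneg fun k _ => abs_nonneg _
  have hi' := abs_nonneg (z i - v i)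
  have hz : ∑ k ∈ Finset.univ.erase i, |z k - v k| = 0 := by omega
  have hi1 : |z i - v i| = 1 := by omega
  rw [Finset.sum_eq_zero_iff_of_nonneg fun k _ => abs_nonneg _] at hz
  have hk : ∀ k, k ≠ i → v k = z k := by
    intro k hk
    have := hz k (by simp [hk])
    rw [abs_eq_zero] at this
    omega
  refine ⟨i, ?_⟩
  rcases (abs_eq one_pos.le).mp hi1 with h | h
  · right
    ext k
    by_cases hki : k = i
    · subst hki; simp; omega
    · simp [hki, hk k hki]
  · left
    ext k
    by_cases hki : k = i
    · subst hki; simp; omega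
    · simp [hki, hk k hki]

lemma tsum_adj_le {d : ℕ} (F : Zd d → ENNReal) (z : Zd d) :
    ∑' v, {v | adj z v}.indicator F v ≤
      ∑ i, (F (z + Pi.single i 1) + F (z + Pi.single i (-1))) := by
  have hle : ∀ v, {v | adj z v}.indicator F v ≤
      ∑ i, ((if v = z + Pi.single i 1 then F v else 0) +
        (if v = z + Pi.single i (-1) then F v else 0)) := by
    intro v
    by_cases hv : adj z v
    · rw [Set.indicator_of_mem (by exact hv)]
      obtain ⟨i, hi⟩ := exists_single_of_adj hv
      refine le_trans ?_ (Finset.single_le_sum (fun _ _ => zero_le) (Finset.mem_univ i))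
      rcases hi with hi | hi
      · rw [if_pos hi]; exact le_self_add
      · rw [if_pos hi]; exact le_add_self
    · rw [Set.indicator_of_notMem (by exact hv)]
      exact zero_le
  refine (ENNReal.tsum_le_tsum hle).trans (le_of_eq ?_)
  rw [Summable.tsum_finsetSum fun _ _ => ENNReal.summable]
  refine Finset.sum_congr rfl fun i _ => ?_
  rw [ENNReal.tsum_add, tsum_ite_eq, tsum_ite_eq]

/-- The paths that agree with `w` up to time `n`. -/
def cylinderAt {d : ℕ} (n : ℕ) (w : ℕ → Zd d) : Set (ℕ → Zd d) := {ω | ∀ k ≤ n, ω k = w k}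

lemma measurableSet_cylinderAt {d : ℕ} (n : ℕ) (w : ℕ → Zd d) :
    MeasurableSet (cylinderAt n w) := by
  have : cylinderAt n w = ⋂ k, ⋂ (_ : k ≤ n), (fun ω : ℕ → Zd d => ω k) ⁻¹' {w k} := by
    ext ω; simp [cylinderAt]
  rw [this]
  exact MeasurableSet.iInter fun k => MeasurableSet.iInter fun _ =>
    measurable_pi_apply k (measurableSet_singleton _)

lemma setLIntegral_next_le {d : ℕ} {P : Zd d → Measure (ℕ → Zd d)} (hP : IsSRW d P)
    (F : Zd d → ENNReal) (hF : ∀ z, ∑' v, {v | adj z v}.indicator F v ≤ 2 * d * F z)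
    (hd : d ≠ 0) (x : Zd d) (n : ℕ) (w : ℕ → Zd d) :
    ∫⁻ ω in cylinderAt n w, F (ω (n + 1)) ∂(P x) ≤ ∫⁻ ω in cylinderAt n w, F (ω n) ∂(P x) := by
  have hmeas : Measurable fun ω : ℕ → Zd d => ω (n + 1) := measurable_pi_apply _
  have hR : ∫⁻ ω in cylinderAt n w, F (ω n) ∂(P x) = F (w n) * P x (cylinderAt n w) := by
    rw [setLIntegral_congr_fun (g := fun _ => F (w n)) (measurableSet_cylinderAt n w)
      fun ω hω => by rw [hω n le_rfl], setLIntegral_const]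
  have hset : ∀ v, (fun ω : ℕ → Zd d => ω (n + 1)) ⁻¹' {v} ∩ cylinderAt n w =
      {ω | ∀ k ≤ n + 1, ω k = Function.update w (n + 1) v k} := by
    intro v
    ext ω
    simp only [Set.mem_inter_iff, Set.mem_preimage, Set.mem_singleton_iff, cylinderAt,
      Set.mem_ofPred_eq]
    constructor
    · rintro ⟨h1, h2⟩ k hk
      rcases Nat.le_succ_iff.mp hk with hk | rfl
      · rw [Function.update_of_ne (by omega), h2 k hk]
      · rw [Function.update_self, h1]
    · intro h
      refine ⟨by simpa using h (n + 1) le_rfl, fun k hk => ?_⟩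
      rw [h k (by omega), Function.update_of_ne (by omega)]
  have hL : ∫⁻ ω in cylinderAt n w, F (ω (n + 1)) ∂(P x) =
      ∑' v, F v * P x {ω | ∀ k ≤ n + 1, ω k = Function.update w (n + 1) v k} := by
    rw [← lintegral_map (f := F) (measurable_of_countable F) hmeas, lintegral_countable']
    refine tsum_congr fun v => ?_
    rw [Measure.map_apply hmeas (measurableSet_singleton v),
      Measure.restrict_apply (hmeas (measurableSet_singleton v)), hset]
  rw [hL, hR]
  by_cases hw : w 0 = x ∧ ∀ k < n, adj (w k) (w (k + 1))
  · have hcyl : P x (cylinderAt n w) = ((2 * d : ENNReal))⁻¹ ^ n := hP.2.1 x n w hw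
    have hterm : ∀ v, F v * P x {ω | ∀ k ≤ n + 1, ω k = Function.update w (n + 1) v k} =
        {v | adj (w n) v}.indicator F v * ((2 * d : ENNReal))⁻¹ ^ (n + 1) := by
      intro v
      by_cases hv : adj (w n) v
      · rw [Set.indicator_of_mem (by exact hv), hP.2.1 x (n + 1)]
        refine ⟨by simpa using hw.1, fun k hk => ?_⟩
        rw [Function.update_of_ne (by omega)]
        rcases Nat.lt_succ_iff_lt_or_eq.mp hk with hk | rfl
        · rw [Function.update_of_ne (by omega)]; exact hw.2 k hk
        · rwa [Function.update_self]
      · rw [Set.indicator_of_notMem (by exact hv), hP.2.2 x (n + 1), mul_zero, zero_mul]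
        rintro ⟨-, h⟩
        apply hv
        have := h n (Nat.lt_succ_self n)
        rwa [Function.update_self, Function.update_of_ne (by omega)] at this
    simp only [hterm]
    rw [ENNReal.tsum_mul_right, hcyl, pow_succ']
    have h0 : (2 * d : ENNReal) ≠ 0 := by simpa using hd
    have ht : (2 * d : ENNReal) ≠ ⊤ := ENNReal.mul_ne_top (by simp) (by simp)
    calc _ ≤ 2 * d * F (w n) * ((2 * d : ENNReal)⁻¹ * (2 * d : ENNReal)⁻¹ ^ n) := by
          gcongr; exact hF _
      _ = (2 * d * (2 * d : ENNReal)⁻¹) * (F (w n) * (2 * d : ENNReal)⁻¹ ^ n) := by ring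
      _ = _ := by rw [ENNReal.mul_inv_cancel h0 ht, one_mul]
  · have hterm : ∀ v, P x {ω | ∀ k ≤ n + 1, ω k = Function.update w (n + 1) v k} = 0 := by
      intro v
      refine le_antisymm ?_ zero_le
      rw [← hP.2.2 x n w hw, ← hset v]
      exact measure_mono Set.inter_subset_right
    simp [hterm]

lemma measurableSet_avoid {d : ℕ} (B : Set (Zd d)) (n : ℕ) :
    MeasurableSet {ω : ℕ → Zd d | ∀ k ≤ n, ω k ∉ B} := by
  have : {ω : ℕ → Zd d | ∀ k ≤ n, ω k ∉ B} =
      ⋂ k, ⋂ (_ : k ≤ n), (fun ω : ℕ → Zd d => ω k) ⁻¹' Bᶜ := by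
    ext ω; simp
  rw [this]
  exact MeasurableSet.iInter fun k => MeasurableSet.iInter fun _ =>
    measurable_pi_apply k (Set.to_countable _).measurableSet

lemma setLIntegral_avoid_next_le {d : ℕ} {P : Zd d → Measure (ℕ → Zd d)} (hP : IsSRW d P)
    (F : Zd d → ENNReal) (hF : ∀ z, ∑' v, {v | adj z v}.indicator F v ≤ 2 * d * F z)
    (hd : d ≠ 0) (x : Zd d) (B : Set (Zd d)) (n : ℕ) :
    ∫⁻ ω in {ω | ∀ k ≤ n, ω k ∉ B}, F (ω (n + 1)) ∂(P x) ≤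
      ∫⁻ ω in {ω | ∀ k ≤ n, ω k ∉ B}, F (ω n) ∂(P x) := by
  let extendPath : (Fin (n + 1) → Zd d) → ℕ → Zd d := fun p k => if h : k < n + 1 then p ⟨k, h⟩ else 0
  have hext : ∀ p k (h : k < n + 1), extendPath p k = p ⟨k, h⟩ := fun p k h => dif_pos h
  have hU : {ω : ℕ → Zd d | ∀ k ≤ n, ω k ∉ B} =
      ⋃ p : {p : Fin (n + 1) → Zd d // ∀ k, p k ∉ B}, cylinderAt n (extendPath p) := by
    ext ω
    simp only [Set.mem_ofPred_eq, Set.mem_iUnion, cylinderAt]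
    constructor
    · intro h
      refine ⟨⟨fun k => ω k, fun k => h k (by omega)⟩, fun k hk => ?_⟩
      rw [hext _ _ (by omega)]
    · rintro ⟨p, hp⟩ k hk
      rw [hp k hk, hext _ _ (by omega)]
      exact p.2 _
  have hdisj : Pairwise (Function.onFun Disjoint
      fun p : {p : Fin (n + 1) → Zd d // ∀ k, p k ∉ B} => cylinderAt n (extendPath p)) := by
    intro p q hpq
    refine Set.disjoint_left.mpr fun ω h1 h2 => hpq (Subtype.ext (funext fun k => ?_))
    have hk : (k : ℕ) ≤ n := by omega
    have := (h1 k hk).symm.trans (h2 k hk)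
    rwa [hext _ _ k.2, hext _ _ k.2] at this
  rw [hU, lintegral_iUnion (fun p => measurableSet_cylinderAt n _) hdisj,
    lintegral_iUnion (fun p => measurableSet_cylinderAt n _) hdisj]
  exact ENNReal.tsum_le_tsum fun p => setLIntegral_next_le hP F hF hd x n _

lemma measure_hit_le_of_superharmonic {d : ℕ} {P : Zd d → Measure (ℕ → Zd d)} (hP : IsSRW d P)
    (F : Zd d → ENNReal) (hF : ∀ z, ∑' v, {v | adj z v}.indicator F v ≤ 2 * d * F z)
    (hd : d ≠ 0) (x : Zd d) (B : Set (Zd d)) (hB : ∀ z ∈ B, 1 ≤ F z) :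
    P x {ω | ∃ m, ω m ∈ B} ≤ F x := by
  have := hP.1 x
  have hBm : MeasurableSet B := (Set.to_countable _).measurableSet
  have hstep : ∀ (A : Set (ℕ → Zd d)) (k : ℕ), MeasurableSet A →
      P x (A ∩ {ω | ω k ∈ B}) + ∫⁻ ω in A ∩ {ω | ω k ∉ B}, F (ω k) ∂(P x) ≤
        ∫⁻ ω in A, F (ω k) ∂(P x) := by
    intro A k hA
    have hm : MeasurableSet {ω : ℕ → Zd d | ω k ∈ B} := measurable_pi_apply k hBm
    rw [← lintegral_inter_add_sdiff (fun ω => F (ω k)) A hm]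
    refine add_le_add ?_ (le_of_eq rfl)
    rw [← setLIntegral_one]
    exact setLIntegral_mono' (hA.inter hm) fun ω hω => hB _ hω.2
  have key : ∀ n, P x {ω | ∃ k ≤ n, ω k ∈ B} +
      ∫⁻ ω in {ω | ∀ k ≤ n, ω k ∉ B}, F (ω n) ∂(P x) ≤ F x := by
    intro n
    induction n with
    | zero =>
      have h := hstep Set.univ 0 MeasurableSet.univ
      have hx : ∀ᵐ ω ∂(P x), ω 0 = x := by
        have h1 : P x {ω | ω 0 = x} = 1 := by
          have := hP.2.1 x 0 (fun _ => x) ⟨rfl, by simp⟩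
          simpa using this
        rw [← prob_compl_eq_zero_iff₀] at h1
        · exact h1
        · exact (measurable_pi_apply (X := fun _ : ℕ => Zd d) 0
            (measurableSet_singleton x)).nullMeasurableSet
      have h2 : ∫⁻ ω in Set.univ, F (ω 0) ∂(P x) = F x := by
        rw [Measure.restrict_univ, lintegral_congr_ae (g := fun _ => F x)
          (hx.mono fun ω hω => by simp only [hω])]
        simp
      rw [h2] at h
      simpa using h
    | succ n ih =>
      refine le_trans ?_ ih
      have h1 : {ω : ℕ → Zd d | ∃ k ≤ n + 1, ω k ∈ B} ⊆ {ω | ∃ k ≤ n, ω k ∈ B} ∪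
          ({ω | ∀ k ≤ n, ω k ∉ B} ∩ {ω | ω (n + 1) ∈ B}) := by
        rintro ω ⟨k, hk, hkB⟩
        by_cases h : ∃ k ≤ n, ω k ∈ B
        · exact Or.inl h
        · push Not at h
          refine Or.inr ⟨h, ?_⟩
          rcases Nat.le_succ_iff.mp hk with hk | rfl
          · exact absurd hkB (h k hk)
          · exact hkB
      have h2 : {ω : ℕ → Zd d | ∀ k ≤ n + 1, ω k ∉ B} =
          {ω | ∀ k ≤ n, ω k ∉ B} ∩ {ω | ω (n + 1) ∉ B} := by
        ext ω
        constructor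
        · exact fun h => ⟨fun k hk => h k (by omega), h (n + 1) le_rfl⟩
        · rintro ⟨h, h'⟩ k hk
          rcases Nat.le_succ_iff.mp hk with hk | rfl
          · exact h k hk
          · exact h'
      calc _ ≤ (P x {ω | ∃ k ≤ n, ω k ∈ B} +
            P x ({ω | ∀ k ≤ n, ω k ∉ B} ∩ {ω | ω (n + 1) ∈ B})) +
            ∫⁻ ω in {ω | ∀ k ≤ n, ω k ∉ B} ∩ {ω | ω (n + 1) ∉ B}, F (ω (n + 1)) ∂(P x) := by
            rw [h2]
            gcongr
            exact (measure_mono h1).trans (measure_union_le _ _)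
        _ ≤ P x {ω | ∃ k ≤ n, ω k ∈ B} +
            ∫⁻ ω in {ω | ∀ k ≤ n, ω k ∉ B}, F (ω (n + 1)) ∂(P x) := by
            rw [add_assoc]
            gcongr
            exact hstep _ _ (measurableSet_avoid B n)
        _ ≤ _ := by
            exact add_le_add le_rfl (setLIntegral_avoid_next_le hP F hF hd x B n)
  have hU : {ω : ℕ → Zd d | ∃ m, ω m ∈ B} = ⋃ n, {ω | ∃ k ≤ n, ω k ∈ B} := by
    ext ω
    simp only [Set.mem_ofPred_eq, Set.mem_iUnion]
    exact ⟨fun ⟨m, hm⟩ => ⟨m, m, le_rfl, hm⟩, fun ⟨_, k, _, hk⟩ => ⟨k, hk⟩⟩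
  have hmono : Monotone fun n => {ω : ℕ → Zd d | ∃ k ≤ n, ω k ∈ B} :=
    fun m n hmn ω ⟨k, hk, hkB⟩ => ⟨k, hk.trans hmn, hkB⟩
  rw [hU, hmono.measure_iUnion]
  exact iSup_le fun n => le_self_add.trans (key n)

lemma sum_range_inv_sqrt_le (n : ℕ) :
    ∑ i ∈ Finset.range n, (√(1 + i))⁻¹ ≤ 2 * √(n : ℝ) := by
  induction n with
  | zero => simp
  | succ n ih =>
    rw [Finset.sum_range_succ]
    have h1 : 0 < √(1 + n : ℝ) := by positivity
    have h2 := Real.sq_sqrt (show (0 : ℝ) ≤ 1 + n by positivity)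
    have h3 := Real.sq_sqrt (show (0 : ℝ) ≤ n by positivity)
    have h4 : (√(1 + n : ℝ))⁻¹ ≤ 2 * (√(1 + n : ℝ) - √n) := by
      rw [inv_le_iff_one_le_mul₀ h1]
      nlinarith [sq_nonneg (√(1 + n : ℝ) - √n)]
    push_cast
    rw [add_comm (n : ℝ) 1]
    linarith

lemma sum_range_inv_sqrt_abs_le {n p : ℕ} (hp : p ≤ n) :
    ∑ j ∈ Finset.range n, (√(1 + |(p : ℝ) - j|))⁻¹ ≤ 4 * √(n : ℝ) := by
  obtain ⟨m, rfl⟩ := Nat.exists_eq_add_of_le hp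
  rw [Finset.sum_range_add]
  have h1 : ∑ j ∈ Finset.range p, (√(1 + |(p : ℝ) - j|))⁻¹ ≤ 2 * √((p + m : ℕ) : ℝ) := by
    rw [← Finset.sum_range_reflect]
    refine le_trans (Finset.sum_le_sum fun j hj => ?_) ((sum_range_inv_sqrt_le p).trans ?_)
    · have hj := Finset.mem_range.mp hj
      rw [Nat.sub_sub, Nat.cast_sub (by omega)]
      gcongr
      push_cast
      refine le_trans ?_ (le_abs_self _)
      linarith
    · gcongr
  have h2 : ∑ j ∈ Finset.range m, (√(1 + |(p : ℝ) - (p + j : ℕ)|))⁻¹ ≤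
      2 * √((p + m : ℕ) : ℝ) := by
    refine le_trans (Finset.sum_le_sum fun j hj => ?_) ((sum_range_inv_sqrt_le m).trans ?_)
    · gcongr
      push_cast
      rw [show (p : ℝ) - (p + j) = -j by ring, abs_neg]
      exact le_abs_self _
    · gcongr; omega
  linarith

lemma inv_sqrt_add_sq_le (a b : ℝ) :
    (√(100 + (a ^ 2 + b ^ 2)))⁻¹ ≤ (√(1 + |a|))⁻¹ * (√(1 + |b|))⁻¹ := by
  rw [← mul_inv, ← Real.sqrt_mul (by positivity)]
  gcongr
  have := sq_abs a
  have := sq_abs b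
  nlinarith [sq_nonneg (|a| - 1), sq_nonneg (|b| - 1), sq_nonneg (|a| - |b|)]

lemma log_le_sum_inv_sqrt {L m : ℕ} (hL : 1 ≤ L) (hm : m ≤ L) :
    Real.log L / 10 ≤ ∑ k ∈ Finset.range (2 * L), (√(100 + ((m : ℝ) - k) ^ 2))⁻¹ := by
  have h1 : Real.log L ≤ ∑ i ∈ Finset.range L, ((i : ℝ) + 1)⁻¹ := by
    have h := log_add_one_le_harmonic L
    rw [harmonic] at h
    push_cast at h
    refine le_trans (Real.log_le_log (by exact_mod_cast hL) (by linarith)) h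
  have h2 : ∑ i ∈ Finset.range L, ((i : ℝ) + 1)⁻¹ / 10 ≤
      ∑ i ∈ Finset.range L, (√(100 + ((m : ℝ) - (m + i : ℕ)) ^ 2))⁻¹ := by
    refine Finset.sum_le_sum fun i _ => ?_
    rw [div_eq_mul_inv, ← mul_inv]
    gcongr
    rw [Real.sqrt_le_left (by positivity)]
    push_cast
    have : (0 : ℝ) ≤ i := by positivity
    nlinarith
  rw [← Finset.sum_div] at h2
  have h3 : ∑ i ∈ Finset.range L, (√(100 + ((m : ℝ) - (m + i : ℕ)) ^ 2))⁻¹ ≤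
      ∑ k ∈ Finset.range (m + L), (√(100 + ((m : ℝ) - k) ^ 2))⁻¹ := by
    rw [Finset.sum_range_add]
    exact le_add_of_nonneg_left (Finset.sum_nonneg fun _ _ => by positivity)
  have h4 : ∑ k ∈ Finset.range (m + L), (√(100 + ((m : ℝ) - k) ^ 2))⁻¹ ≤
      ∑ k ∈ Finset.range (2 * L), (√(100 + ((m : ℝ) - k) ^ 2))⁻¹ :=
    Finset.sum_le_sum_of_subset_of_nonneg (Finset.range_mono (by omega))
      fun _ _ _ => by positivity
  linarith

lemma toReal_measure_hit_segment_le {d : ℕ} (hd : 3 ≤ d) {L : ℕ} (hL : 2 ≤ L) {y : Zd d}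
    {P : Zd d → Measure (ℕ → Zd d)} (hP : IsSRW d P) {x : Zd d}
    (hx : ∀ i : Fin d, 2 ≤ (i : ℕ) → x i = y i) (j : ℕ) :
    (P x {ω | ∃ m : ℕ, ω m ∈
      {z : Zd d | (∀ i : Fin d, 2 ≤ (i : ℕ) → z i = y i) ∧
        coord z 0 - coord y 0 = (j : ℤ) ∧
        0 ≤ coord z 1 - coord y 1 ∧ coord z 1 - coord y 1 ≤ (L : ℤ)}}).toReal ≤
    10 / Real.log L * ∑ k ∈ Finset.range (2 * L),
      (√(100 + (((coord x 0 - coord y 0 : ℤ) - (j : ℝ)) ^ 2 +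
        ((coord x 1 - coord y 1 : ℤ) - (k : ℝ)) ^ 2)))⁻¹ := by
  have hlog : 0 < Real.log L := Real.log_pos (by exact_mod_cast hL)
  let i0 : Fin d := ⟨0, by omega⟩
  let i1 : Fin d := ⟨1, by omega⟩
  let i2 : Fin d := ⟨2, by omega⟩
  have h01 : i0 ≠ i1 := by simp [i0, i1]
  have h02 : i0 ≠ i2 := by simp [i0, i2]
  have h12 : i1 ≠ i2 := by simp [i1, i2]
  have hc0 : ∀ z : Zd d, coord z 0 = z i0 := fun z => dif_pos _
  have hc1 : ∀ z : Zd d, coord z 1 = z i1 := fun z => dif_pos _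
  let c : ℕ → Zd d := fun k => y + Pi.single i0 (j : ℤ) + Pi.single i1 (k : ℤ)
  have hS : ({i0, i1, i2} : Finset (Fin d)).card = 3 := Finset.card_eq_three.mpr
    ⟨i0, i1, i2, h01, h02, h12, rfl⟩
  have hval : ∀ (z : Zd d), (∀ i : Fin d, 2 ≤ (i : ℕ) → z i = y i) → ∀ k : ℕ,
      newtonKernel {i0, i1, i2} (c k) z =
        (√(100 + (((coord z 0 - coord y 0 : ℤ) - (j : ℝ)) ^ 2 +
          ((coord z 1 - coord y 1 : ℤ) - (k : ℝ)) ^ 2)))⁻¹ := by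
    intro z hz k
    have h2 : z i2 = y i2 := hz i2 le_rfl
    unfold newtonKernel
    rw [Finset.sum_insert (by simp [h01, h02]), Finset.sum_insert (by simp [h12]),
      Finset.sum_singleton, hc0, hc0, hc1, hc1]
    simp only [c, Pi.add_apply, Pi.single_eq_same, Pi.single_eq_of_ne h01,
      Pi.single_eq_of_ne h01.symm, Pi.single_eq_of_ne h02.symm, Pi.single_eq_of_ne h12.symm, h2]
    congr 2
    push_cast
    ring
  let f : Zd d → ℝ := fun z =>
    10 / Real.log L * ∑ k ∈ Finset.range (2 * L), newtonKernel {i0, i1, i2} (c k) z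
  have hf0 : ∀ z, 0 ≤ f z := fun z => mul_nonneg (by positivity)
    (Finset.sum_nonneg fun k _ => newtonKernel_nonneg _ _ _)
  have hfx : f x = 10 / Real.log L * ∑ k ∈ Finset.range (2 * L),
      (√(100 + (((coord x 0 - coord y 0 : ℤ) - (j : ℝ)) ^ 2 +
        ((coord x 1 - coord y 1 : ℤ) - (k : ℝ)) ^ 2)))⁻¹ := by
    simp only [f, hval x hx]
  rw [← hfx]
  refine ENNReal.toReal_le_of_le_ofReal (hf0 x) ?_
  refine measure_hit_le_of_superharmonic hP (fun z => ENNReal.ofReal (f z)) (fun z => ?_)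
    (by omega) x _ ?_
  · refine (tsum_adj_le _ z).trans ?_
    have hsuper : ∑ i, (f (z + Pi.single i 1) + f (z + Pi.single i (-1))) ≤ 2 * d * f z := by
      simp only [f, ← mul_add, ← Finset.sum_add_distrib, ← Finset.mul_sum]
      rw [Finset.sum_comm, mul_left_comm, Finset.mul_sum (Finset.range _) _ (2 * (d : ℝ))]
      gcongr with k
      exact newtonKernel_superharmonic _ hS (c k) z
    simp only [← ENNReal.ofReal_add (hf0 _) (hf0 _)]
    rw [← ENNReal.ofReal_sum_of_nonneg fun i _ => add_nonneg (hf0 _) (hf0 _)]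
    refine (ENNReal.ofReal_le_ofReal hsuper).trans (le_of_eq ?_)
    rw [ENNReal.ofReal_mul (by positivity), ENNReal.ofReal_mul (by norm_num)]
    simp
  · rintro z ⟨hz, hz0, hz1, hzL⟩
    rw [ENNReal.one_le_ofReal]
    obtain ⟨m, hm⟩ := Int.eq_ofNat_of_zero_le hz1
    have h := log_le_sum_inv_sqrt (L := L) (m := m) (by omega) (by omega)
    simp only [f, hval z hz, hz0, hm]
    simp only [Int.cast_natCast, sub_self, zero_pow two_ne_zero, zero_add]
    calc (1 : ℝ) = 10 / Real.log L * (Real.log L / 10) := by field_simp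
      _ ≤ _ := by gcongr

/-- **Expected number of vertical segments of a square hit by the walk** ((3.15)).
For a square `C` of side `L` in the `e₁`–`e₂` plane with vertical segments
`I_j`, `0 ≤ j < L`: `sup_{x ∈ C} E_x[Σ_{0 ≤ j < L} 1_{H_{I_j} < ∞}] ≤ c L / log L`. -/
theorem expected_hit_segments_square (d : ℕ) (hd : 3 ≤ d) :
    ∃ c : ℝ, 0 < c ∧
      ∀ L : ℕ, 2 ≤ L → ∀ y : Zd d,
        ∀ (P : Zd d → Measure (ℕ → Zd d)), IsSRW d P →
          ∀ x : Zd d,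
            x ∈ {z : Zd d | (∀ i : Fin d, 2 ≤ (i : ℕ) → z i = y i) ∧
                0 ≤ coord z 0 - coord y 0 ∧ coord z 0 - coord y 0 ≤ (L : ℤ) ∧
                0 ≤ coord z 1 - coord y 1 ∧ coord z 1 - coord y 1 ≤ (L : ℤ)} →
            (∑ j ∈ Finset.range L,
                (P x {ω | ∃ m : ℕ, ω m ∈
                  {z : Zd d | (∀ i : Fin d, 2 ≤ (i : ℕ) → z i = y i) ∧
                    coord z 0 - coord y 0 = (j : ℤ) ∧
                    0 ≤ coord z 1 - coord y 1 ∧ coord z 1 - coord y 1 ≤ (L : ℤ)}}).toReal) ≤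
              c * (L : ℝ) / Real.log L := by
  refine ⟨320, by norm_num, ?_⟩
  rintro L hL y P hP x ⟨hx, hx0, hx0L, hx1, hx1L⟩
  have hlog : 0 < Real.log L := Real.log_pos (by exact_mod_cast hL)
  obtain ⟨p, hp⟩ := Int.eq_ofNat_of_zero_le hx0
  obtain ⟨q, hq⟩ := Int.eq_ofNat_of_zero_le hx1
  have hp' : p ≤ L := by omega
  have hq' : q ≤ 2 * L := by omega
  calc _ ≤ ∑ j ∈ Finset.range L, 10 / Real.log L * ∑ k ∈ Finset.range (2 * L),
        (√(1 + |(p : ℝ) - j|))⁻¹ * (√(1 + |(q : ℝ) - k|))⁻¹ := by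
        refine Finset.sum_le_sum fun j _ => ?_
        refine (toReal_measure_hit_segment_le hd hL hP hx j).trans ?_
        rw [hp, hq]
        gcongr with k
        exact inv_sqrt_add_sq_le _ _
    _ = 10 / Real.log L * ((∑ j ∈ Finset.range L, (√(1 + |(p : ℝ) - j|))⁻¹) *
        ∑ k ∈ Finset.range (2 * L), (√(1 + |(q : ℝ) - k|))⁻¹) := by
        rw [← Finset.mul_sum, Finset.sum_mul_sum]
    _ ≤ 10 / Real.log L * ((4 * √((2 * L : ℕ) : ℝ)) * (4 * √((2 * L : ℕ) : ℝ))) := by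
        gcongr
        · refine (sum_range_inv_sqrt_abs_le hp').trans ?_
          gcongr
          omega
        · exact sum_range_inv_sqrt_abs_le hq'
    _ = 320 * L / Real.log L := by
        rw [mul_mul_mul_comm, Real.mul_self_sqrt (by positivity)]
        push_cast
        ring
end

section
/- Let d ≥ 3. There is a constant c > 0 depending only on d such that for every sufficiently large integer L_0 and every choice of integers (ℓ_k)_{0≤k<K} with |ℓ_k| < K', the following holds: for every x ∈ ∪_{0≤k<K} C_{k,ℓ_k}, Σ_{0≤k<K} P_x[ H_{B_{k,ℓ_k}} < ∞ ] ≤ c · log(L_0/L). -/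
open MeasureTheory Filter

namespace RI

/-- `M = ⌊L₀ exp(-(log L₀)^{1/3})⌋`, so that the smaller scale is `L = 1000 M`. -/
noncomputable def Mof (L0 : ℕ) : ℕ :=
  ⌊(L0 : ℝ) * Real.exp (-(Real.log L0) ^ ((1 : ℝ) / 3))⌋₊

/-- The smaller length scale `L = 1000 ⌊L₀ exp(-(log L₀)^{1/3})⌋`. -/
noncomputable def Lof (L0 : ℕ) : ℕ := 1000 * Mof L0

/-- `K = ⌊2L₀/L⌋`. -/
noncomputable def Kof (L0 : ℕ) : ℕ := 2 * L0 / Lof L0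

/-- `K' = ⌊10⁴ L₀/L⌋`. -/
noncomputable def K'of (L0 : ℕ) : ℕ := 10000 * L0 / Lof L0

/-- The square `C_{k,ℓ} = (kL e₁ + (ℓL/1000) e₂ + [0,L]² × {0}^{d-2}) ∩ ℤ^d`. -/
noncomputable def CklSet (d : ℕ) (L0 : ℕ) (k : ℕ) (l : ℤ) : Set (Zd d) :=
  {x | inPlane x ∧ (k * Lof L0 : ℤ) ≤ coord x 0 ∧ coord x 0 ≤ (k * Lof L0 : ℤ) + (Lof L0 : ℤ) ∧
       l * (Mof L0 : ℤ) ≤ coord x 1 ∧ coord x 1 ≤ l * (Mof L0 : ℤ) + (Lof L0 : ℤ)}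

/-- The vertical segment `I_v = π₁⁻¹(v) ∩ C_{k,ℓ}`. -/
noncomputable def segSet (d : ℕ) (L0 : ℕ) (k : ℕ) (l : ℤ) (v : ℤ) : Set (Zd d) :=
  {x | x ∈ CklSet d L0 k l ∧ coord x 0 = v}


/-- The `d`-dimensional box `B_{k,ℓ} = (kL e₁ + (ℓL/1000) e₂ + [0,L]² × [0,L]^{d-2}) ∩ ℤ^d`. -/
noncomputable def BklSet (d : ℕ) (L0 : ℕ) (k : ℕ) (l : ℤ) : Set (Zd d) :=
  {x | (k * Lof L0 : ℤ) ≤ coord x 0 ∧ coord x 0 ≤ (k * Lof L0 : ℤ) + (Lof L0 : ℤ) ∧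
       l * (Mof L0 : ℤ) ≤ coord x 1 ∧ coord x 1 ≤ l * (Mof L0 : ℤ) + (Lof L0 : ℤ) ∧
       ∀ i : Fin d, 2 ≤ (i : ℕ) → 0 ≤ x i ∧ x i ≤ (Lof L0 : ℤ)}

end RI

open RI MeasureTheory Filter

section Walk

variable {d : ℕ}

theorem adj_add_single (x : Zd d) (i : Fin d) : adj x (x + Pi.single i 1) := by
  simp [adj, Pi.single_apply, apply_ite abs]

theorem adj_sub_single (x : Zd d) (i : Fin d) : adj x (x - Pi.single i 1) := by
  simp [adj, Pi.single_apply, apply_ite abs]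

theorem RI.adj.exists_single {x y : Zd d} (h : adj x y) :
    ∃ i, y = x + Pi.single i 1 ∨ y = x - Pi.single i 1 := by
  unfold adj at h
  obtain ⟨i, hi⟩ : ∃ i, x i - y i ≠ 0 := by
    by_contra! h0
    simp [h0] at h
  rw [← Finset.add_sum_erase _ _ (Finset.mem_univ i)] at h
  have hpos : 0 < |x i - y i| := abs_pos.2 hi
  have hnn : 0 ≤ ∑ j ∈ Finset.univ.erase i, |x j - y j| :=
    Finset.sum_nonneg fun _ _ => abs_nonneg _
  have hzero : ∑ j ∈ Finset.univ.erase i, |x j - y j| = 0 := by omega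
  rw [Finset.sum_eq_zero_iff_of_nonneg fun _ _ => abs_nonneg _] at hzero
  have hoff : ∀ j, j ≠ i → y j = x j := fun j hj => by
    have := abs_eq_zero.1 (hzero j (by simp [hj]))
    omega
  have hone : |x i - y i| = 1 := by omega
  refine ⟨i, ?_⟩
  rcases (abs_eq zero_le_one).1 hone with h1 | h1
  · right
    funext j
    by_cases hj : j = i
    · subst hj; simp; omega
    · simp [hoff j hj, hj]
  · left
    funext j
    by_cases hj : j = i
    · subst hj; simp; omega
    · simp [hoff j hj, hj]

/-- Given a prefix `w 0, …, w k`, the walk follows it and then enters `B` during `[k, k + n]`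
with probability at most `(2d)⁻ᵏ h (w k)`, for every nonnegative superharmonic `h` that is at
least `1` on `B`. -/
theorem RI.IsSRW.prefix_hit_le {P : Zd d → Measure (ℕ → Zd d)} (hP : IsSRW d P) (hd : 0 < d)
    {B : Set (Zd d)} {h : Zd d → ℝ} (h0 : ∀ y, 0 ≤ h y) (h1 : ∀ y ∈ B, 1 ≤ h y)
    (hsup : ∀ y, ∑ i, (h (y + Pi.single i 1) + h (y - Pi.single i 1)) ≤ 2 * d * h y)
    (x : Zd d) (n : ℕ) : ∀ (k : ℕ) (w : ℕ → Zd d), w 0 = x → (∀ j < k, adj (w j) (w (j + 1))) →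
      (P x).real {ω | (∀ j ≤ k, ω j = w j) ∧ ∃ m, k ≤ m ∧ m ≤ k + n ∧ ω m ∈ B}
        ≤ (2 * d : ℝ)⁻¹ ^ k * h (w k) := by
  have := hP.1 x
  have hcyl : ∀ (k : ℕ) (w : ℕ → Zd d), w 0 = x → (∀ j < k, adj (w j) (w (j + 1))) →
      (P x).real {ω | ∀ j ≤ k, ω j = w j} = (2 * d : ℝ)⁻¹ ^ k := fun k w hw0 hw => by
    rw [measureReal_def, hP.2.1 x k w ⟨hw0, hw⟩]
    simp
  have hin : ∀ (n k : ℕ) (w : ℕ → Zd d), w 0 = x → (∀ j < k, adj (w j) (w (j + 1))) → w k ∈ B →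
      (P x).real {ω | (∀ j ≤ k, ω j = w j) ∧ ∃ m, k ≤ m ∧ m ≤ k + n ∧ ω m ∈ B}
        ≤ (2 * d : ℝ)⁻¹ ^ k * h (w k) := fun n k w hw0 hw hB =>
    calc _ ≤ (P x).real {ω | ∀ j ≤ k, ω j = w j} := measureReal_mono fun ω hω => hω.1
      _ = (2 * d : ℝ)⁻¹ ^ k := hcyl k w hw0 hw
      _ ≤ (2 * d : ℝ)⁻¹ ^ k * h (w k) := le_mul_of_one_le_right (by positivity) (h1 _ hB)
  induction n with
  | zero =>
    intro k w hw0 hw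
    by_cases hB : w k ∈ B
    · exact hin 0 k w hw0 hw hB
    · have hempty : {ω : ℕ → Zd d |
          (∀ j ≤ k, ω j = w j) ∧ ∃ m, k ≤ m ∧ m ≤ k + 0 ∧ ω m ∈ B} = ∅ := by
        ext ω
        simp only [Set.mem_ofPred_eq, Set.mem_empty_iff_false, iff_false, not_and]
        rintro hω ⟨m, hm, hm', hmB⟩
        obtain rfl : m = k := by omega
        exact hB (hω m le_rfl ▸ hmB)
      rw [hempty, measureReal_empty]
      exact mul_nonneg (by positivity) (h0 _)
  | succ n ih =>
    intro k w hw0 hw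
    by_cases hB : w k ∈ B
    · exact hin (n + 1) k w hw0 hw hB
    set A : Zd d → Set (ℕ → Zd d) := fun z =>
      {ω | (∀ j ≤ k + 1, ω j = Function.update w (k + 1) z j) ∧
        ∃ m, k + 1 ≤ m ∧ m ≤ k + 1 + n ∧ ω m ∈ B} with hA
    set N : Set (ℕ → Zd d) := ⋃ z : {z : Zd d // ¬ adj (w k) z},
      {ω | ∀ j ≤ k + 1, ω j = Function.update w (k + 1) z.1 j} with hN
    have hsub : {ω : ℕ → Zd d |
        (∀ j ≤ k, ω j = w j) ∧ ∃ m, k ≤ m ∧ m ≤ k + (n + 1) ∧ ω m ∈ B} ⊆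
        N ∪ ⋃ i, (A (w k + Pi.single i 1) ∪ A (w k - Pi.single i 1)) := by
      rintro ω ⟨hω, m, hm, hm', hmB⟩
      have hpre : ∀ j ≤ k + 1, ω j = Function.update w (k + 1) (ω (k + 1)) j := fun j hj => by
        by_cases hjk : j = k + 1
        · subst hjk; simp
        · rw [Function.update_of_ne hjk]; exact hω j (by omega)
      by_cases hadj : adj (w k) (ω (k + 1))
      · have hmk : m ≠ k := by
          rintro rfl
          exact hB (hω m le_rfl ▸ hmB)
        have hmem : ω ∈ A (ω (k + 1)) := ⟨hpre, m, by omega, by omega, hmB⟩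
        obtain ⟨i, hi | hi⟩ := adj.exists_single hadj
        · exact Or.inr (Set.mem_iUnion.2 ⟨i, Or.inl (hi ▸ hmem)⟩)
        · exact Or.inr (Set.mem_iUnion.2 ⟨i, Or.inr (hi ▸ hmem)⟩)
      · exact Or.inl (Set.mem_iUnion.2 ⟨⟨ω (k + 1), hadj⟩, hpre⟩)
    have hN0 : (P x).real N = 0 := by
      rw [measureReal_def, hN, measure_iUnion_null fun z => ?_, ENNReal.toReal_zero]
      refine hP.2.2 x (k + 1) _ fun hc => z.2 ?_
      simpa [Function.update_of_ne (show k ≠ k + 1 by omega)] using hc.2 k (by omega)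
    have hstep : ∀ z, adj (w k) z → (P x).real (A z) ≤ (2 * d : ℝ)⁻¹ ^ (k + 1) * h z :=
      fun z hz => by
        have hz' := ih (k + 1) (Function.update w (k + 1) z)
          (by rw [Function.update_of_ne (by omega), hw0]) fun j hj => by
            rw [Function.update_of_ne (by omega : j ≠ k + 1)]
            by_cases hjk : j = k
            · subst hjk; simpa using hz
            · rw [Function.update_of_ne (by omega)]; exact hw j (by omega)
        rwa [Function.update_self] at hz'
    calc _ ≤ (P x).real (N ∪ ⋃ i, (A (w k + Pi.single i 1) ∪ A (w k - Pi.single i 1))) :=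
          measureReal_mono hsub
      _ ≤ (P x).real N
          + (P x).real (⋃ i, (A (w k + Pi.single i 1) ∪ A (w k - Pi.single i 1))) :=
          measureReal_union_le _ _
      _ ≤ ∑ i, (P x).real (A (w k + Pi.single i 1) ∪ A (w k - Pi.single i 1)) := by
          rw [hN0, zero_add]
          exact measureReal_iUnion_fintype_le _
      _ ≤ ∑ i, (2 * d : ℝ)⁻¹ ^ (k + 1) * (h (w k + Pi.single i 1) + h (w k - Pi.single i 1)) := by
          refine Finset.sum_le_sum fun i _ => (measureReal_union_le _ _).trans ?_
          rw [mul_add]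
          exact add_le_add (hstep _ (adj_add_single _ _)) (hstep _ (adj_sub_single _ _))
      _ ≤ (2 * d : ℝ)⁻¹ ^ (k + 1) * (2 * d * h (w k)) := by
          rw [← Finset.mul_sum]
          gcongr
          exact hsup _
      _ = (2 * d : ℝ)⁻¹ ^ k * h (w k) := by
          have : (d : ℝ) ≠ 0 := by positivity
          rw [pow_succ]
          field_simp

/-- The probability of ever hitting `B` is at most any nonnegative superharmonic function that is
at least `1` on `B`. -/
theorem RI.IsSRW.hit_le {P : Zd d → Measure (ℕ → Zd d)} (hP : IsSRW d P) (hd : 0 < d)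
    {B : Set (Zd d)} {h : Zd d → ℝ} (h0 : ∀ y, 0 ≤ h y) (h1 : ∀ y ∈ B, 1 ≤ h y)
    (hsup : ∀ y, ∑ i, (h (y + Pi.single i 1) + h (y - Pi.single i 1)) ≤ 2 * d * h y)
    (x : Zd d) : (P x {ω | ∃ m, ω m ∈ B}).toReal ≤ h x := by
  have := hP.1 x
  set S : ℕ → Set (ℕ → Zd d) := fun n => {ω | ∃ m ≤ n, ω m ∈ B} with hS
  have hmono : Monotone S := fun a b hab ω ⟨m, hm, hB⟩ => ⟨m, hm.trans hab, hB⟩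
  have hU : {ω : ℕ → Zd d | ∃ m, ω m ∈ B} = ⋃ n, S n := by
    ext ω
    simp only [hS, Set.mem_ofPred_eq, Set.mem_iUnion]
    exact ⟨fun ⟨m, hm⟩ => ⟨m, m, le_rfl, hm⟩, fun ⟨_, m, _, hm⟩ => ⟨m, hm⟩⟩
  have hstart : P x {ω | ω 0 = x}ᶜ = 0 := by
    have hsub : {ω : ℕ → Zd d | ω 0 = x}ᶜ ⊆ ⋃ z : {z : Zd d // z ≠ x},
        {ω | ∀ j ≤ 0, ω j = (fun _ => z.1) j} := fun ω hω =>
      Set.mem_iUnion.2 ⟨⟨ω 0, hω⟩, fun j hj => by simp [Nat.le_zero.1 hj]⟩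
    exact measure_mono_null hsub (measure_iUnion_null fun z =>
      hP.2.2 x 0 _ fun hc => z.2 hc.1)
  have hfin : ∀ n, (P x).real (S n) ≤ h x := fun n => by
    have hn := IsSRW.prefix_hit_le hP hd h0 h1 hsup x n 0 (fun _ => x) rfl (by simp)
    rw [pow_zero, one_mul] at hn
    calc (P x).real (S n) ≤ (P x).real ({ω | ω 0 = x}ᶜ ∪
          {ω | (∀ j ≤ 0, ω j = (fun _ => x) j) ∧ ∃ m, 0 ≤ m ∧ m ≤ 0 + n ∧ ω m ∈ B}) := by
          refine measureReal_mono ?_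
          rintro ω ⟨m, hm, hmB⟩
          by_cases hω : ω 0 = x
          · exact Or.inr ⟨fun j hj => by rw [Nat.le_zero.1 hj, hω], m, by omega, by omega, hmB⟩
          · exact Or.inl hω
      _ ≤ _ := measureReal_union_le _ _
      _ ≤ h x := by
          rw [measureReal_def, hstart]
          simpa using hn
  have hlim := (ENNReal.tendsto_toReal (measure_ne_top (P x) (⋃ n, S n))).comp
    (tendsto_measure_iUnion_atTop hmono)
  rw [hU]
  exact le_of_tendsto' hlim hfin

end Walk

section Newton

/-- A fourth-order upper bound for `(1 + u)^(-1/2)` near `0`. -/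
theorem one_div_sqrt_one_add_le {u : ℝ} (hu : -(1 / 2) ≤ u) (hu' : u ≤ 1 / 2) :
    1 / √(1 + u) ≤ 1 - u / 2 + 3 / 8 * u ^ 2 - 5 / 16 * u ^ 3 + u ^ 4 := by
  have hp : 0 ≤ 1 - u / 2 + 3 / 8 * u ^ 2 - 5 / 16 * u ^ 3 + u ^ 4 := by
    nlinarith [sq_nonneg u, sq_nonneg (u ^ 2), mul_nonneg (sq_nonneg u) (sub_nonneg.2 hu')]
  have hq : 0 ≤ 93 / 64 + 39 / 32 * u - 99 / 256 * u ^ 2 + 57 / 256 * u ^ 3 + 3 / 8 * u ^ 4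
      + u ^ 5 := by
    have h2 : u ^ 2 ≤ 1 / 4 := by nlinarith
    have h3 : -(1 / 8) ≤ u ^ 3 := by nlinarith
    have h5 : -(1 / 32) ≤ u ^ 5 := by nlinarith [sq_nonneg u]
    nlinarith [sq_nonneg (u ^ 2)]
  have hsq : 1 ≤ (1 + u) * (1 - u / 2 + 3 / 8 * u ^ 2 - 5 / 16 * u ^ 3 + u ^ 4) ^ 2 := by
    have := mul_nonneg (by positivity : 0 ≤ u ^ 4) hq
    linarith
  have hpos : 0 < 1 + u := by linarith
  rw [div_le_iff₀ (Real.sqrt_pos.2 hpos), ← Real.sqrt_sq hp, ← Real.sqrt_mul (sq_nonneg _),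
    Real.one_le_sqrt]
  linarith

theorem one_div_sqrt_add_one_div_sqrt_le {s y : ℝ} (hs : y ^ 2 + 6 ≤ s) :
    1 / √(s + 1 + 2 * y) + 1 / √(s + 1 - 2 * y) ≤
      1 / √s * (2 - 1 / s + (3 / 4 + 3 * y ^ 2) / s ^ 2
        + (2 + 48 * y ^ 2 + 32 * y ^ 4) / s ^ 4) := by
  have hs0 : 0 < s := by nlinarith
  have key : ∀ v : ℝ, -(s / 2) ≤ v → v ≤ s / 2 →
      1 / √(s + v) ≤ 1 / √s * (1 - v / s / 2 + 3 / 8 * (v / s) ^ 2 - 5 / 16 * (v / s) ^ 3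
        + (v / s) ^ 4) := fun v h1 h2 => by
    have hv : s + v = s * (1 + v / s) := by field_simp
    rw [hv, Real.sqrt_mul hs0.le, ← one_div_mul_one_div]
    gcongr
    refine one_div_sqrt_one_add_le ?_ ?_
    · rw [le_div_iff₀ hs0]; linarith
    · rw [div_le_iff₀ hs0]; linarith
  have h1 := key (1 + 2 * y) (by nlinarith [sq_nonneg (y + 2)]) (by nlinarith [sq_nonneg (y - 2)])
  have h2 := key (1 - 2 * y) (by nlinarith [sq_nonneg (y - 2)]) (by nlinarith [sq_nonneg (y + 2)])
  rw [add_assoc, add_sub_assoc]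
  refine (add_le_add h1 h2).trans ?_
  rw [← mul_add]
  refine mul_le_mul_of_nonneg_left ?_ (by positivity)
  have hdrop : 0 ≤ 5 / 16 * ((2 + 24 * y ^ 2) / s ^ 3) := by positivity
  have hid : (1 - (1 + 2 * y) / s / 2 + 3 / 8 * ((1 + 2 * y) / s) ^ 2
        - 5 / 16 * ((1 + 2 * y) / s) ^ 3 + ((1 + 2 * y) / s) ^ 4)
      + (1 - (1 - 2 * y) / s / 2 + 3 / 8 * ((1 - 2 * y) / s) ^ 2
        - 5 / 16 * ((1 - 2 * y) / s) ^ 3 + ((1 - 2 * y) / s) ^ 4)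
      = 2 - 1 / s + (3 / 4 + 3 * y ^ 2) / s ^ 2 + (2 + 48 * y ^ 2 + 32 * y ^ 4) / s ^ 4
        - 5 / 16 * ((2 + 24 * y ^ 2) / s ^ 3) := by
    field_simp
    ring
  linarith

/-- The function `(|y|² + a)^(-1/2)` on `ℤ³` is superharmonic for the simple random walk. -/
theorem newton_superharmonic {a : ℝ} (ha : 30 ≤ a) (p q r : ℝ) {s : ℝ}
    (hs : s = p ^ 2 + q ^ 2 + r ^ 2 + a) :
    (1 / √(s + 1 + 2 * p) + 1 / √(s + 1 - 2 * p))
      + (1 / √(s + 1 + 2 * q) + 1 / √(s + 1 - 2 * q))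
      + (1 / √(s + 1 + 2 * r) + 1 / √(s + 1 - 2 * r)) ≤ 6 * (1 / √s) := by
  have hp := one_div_sqrt_add_one_div_sqrt_le (s := s) (y := p) (by nlinarith)
  have hq := one_div_sqrt_add_one_div_sqrt_le (s := s) (y := q) (by nlinarith)
  have hr := one_div_sqrt_add_one_div_sqrt_le (s := s) (y := r) (by nlinarith)
  have hs1 : 1 ≤ s := by nlinarith
  have hs0 : 0 < s := by linarith
  refine (add_le_add (add_le_add hp hq) hr).trans ?_
  rw [← mul_add, ← mul_add, mul_comm 6]
  gcongr
  set R := p ^ 2 + q ^ 2 + r ^ 2 with hR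
  have hR0 : 0 ≤ R := by positivity
  have hRs : R ≤ s := by linarith
  have h4 : p ^ 4 + q ^ 4 + r ^ 4 ≤ s ^ 2 := by
    have : p ^ 4 + q ^ 4 + r ^ 4 ≤ R ^ 2 := by
      rw [hR]
      nlinarith [mul_nonneg (sq_nonneg p) (sq_nonneg q), mul_nonneg (sq_nonneg p) (sq_nonneg r),
        mul_nonneg (sq_nonneg q) (sq_nonneg r)]
    nlinarith
  have hnum : -3 * s ^ 3 + (9 / 4 + 3 * R) * s ^ 2 + 6 + 48 * R
      + 32 * (p ^ 4 + q ^ 4 + r ^ 4) ≤ 0 := by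
    have hs2 : s ≤ s ^ 2 := by nlinarith
    have h3 : -3 * s ^ 3 + 3 * R * s ^ 2 = -3 * a * s ^ 2 := by rw [hs]; ring
    nlinarith [mul_nonneg (sub_nonneg.2 ha) (sq_nonneg s)]
  have hid : (2 - 1 / s + (3 / 4 + 3 * p ^ 2) / s ^ 2 + (2 + 48 * p ^ 2 + 32 * p ^ 4) / s ^ 4)
      + (2 - 1 / s + (3 / 4 + 3 * q ^ 2) / s ^ 2 + (2 + 48 * q ^ 2 + 32 * q ^ 4) / s ^ 4)
      + (2 - 1 / s + (3 / 4 + 3 * r ^ 2) / s ^ 2 + (2 + 48 * r ^ 2 + 32 * r ^ 4) / s ^ 4)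
      = 6 + (-3 * s ^ 3 + (9 / 4 + 3 * R) * s ^ 2 + 6 + 48 * R
      + 32 * (p ^ 4 + q ^ 4 + r ^ 4)) / s ^ 4 := by
    rw [hR]
    field_simp
    ring
  rw [hid]
  have := div_nonpos_of_nonpos_of_nonneg hnum (by positivity : 0 ≤ s ^ 4)
  linarith

/-- The function `y ↦ (|y - (a, b, 0)|² + A)^(-1/2)` of the first three coordinates of `y`. -/
noncomputable def newton {n : ℕ} (a b : ℤ) (A : ℝ) (y : Zd (n + 3)) : ℝ :=
  1 / √(((y 0 : ℝ) - a) ^ 2 + ((y 1 : ℝ) - b) ^ 2 + (y 2 : ℝ) ^ 2 + A)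

theorem sum_newton_le {n : ℕ} (a b : ℤ) {A : ℝ} (hA : 30 ≤ A) (y : Zd (n + 3)) :
    ∑ i, (newton a b A (y + Pi.single i 1) + newton a b A (y - Pi.single i 1))
      ≤ 2 * (n + 3 : ℕ) * newton a b A y := by
  have h10 : (1 : Fin (n + 3)) ≠ 0 := by simp
  have hv2 : 2 % (n + 3) = 2 := Nat.mod_eq_of_lt (by omega)
  have h20 : (2 : Fin (n + 3)) ≠ 0 := by simp [Fin.ext_iff, hv2]
  have h21 : (2 : Fin (n + 3)) ≠ 1 := by simp [Fin.ext_iff, hv2]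
  have hrest : ∀ i : Fin (n + 3), i ∉ ({0, 1, 2} : Finset (Fin (n + 3))) →
      newton a b A (y + Pi.single i 1) + newton a b A (y - Pi.single i 1)
        - 2 * newton a b A y = 0 := fun i hi => by
    simp only [Finset.mem_insert, Finset.mem_singleton, not_or] at hi
    simp only [newton, Pi.add_apply, Pi.sub_apply, Pi.single_eq_of_ne (Ne.symm hi.1),
      Pi.single_eq_of_ne (Ne.symm hi.2.1), Pi.single_eq_of_ne (Ne.symm hi.2.2), add_zero, sub_zero]
    ring
  have hsum : ∑ i, (newton a b A (y + Pi.single i 1) + newton a b A (y - Pi.single i 1)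
      - 2 * newton a b A y) ≤ 0 := by
    rw [← Finset.sum_subset (Finset.subset_univ {0, 1, 2}) fun i _ hi => hrest i hi,
      Finset.sum_insert (by simp [h10.symm, h20.symm]), Finset.sum_insert (by simp [h21.symm]),
      Finset.sum_singleton]
    have key := newton_superharmonic hA ((y 0 : ℝ) - a) ((y 1 : ℝ) - b) (y 2 : ℝ) rfl
    simp only [newton, Pi.add_apply, Pi.sub_apply, Pi.single_eq_same, Pi.single_eq_of_ne h10,
      Pi.single_eq_of_ne h20, Pi.single_eq_of_ne h21, Pi.single_eq_of_ne h10.symm,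
      Pi.single_eq_of_ne h20.symm, Pi.single_eq_of_ne h21.symm, add_zero, sub_zero,
      Int.cast_add, Int.cast_sub, Int.cast_one]
    ring_nf at key ⊢
    linarith
  rw [Finset.sum_sub_distrib] at hsum
  simp only [Finset.sum_const, Finset.card_univ, Fintype.card_fin, nsmul_eq_mul] at hsum
  linarith

end Newton

theorem hit_box_le {n L0 : ℕ} (hL : 30 ≤ Lof L0) {P : Zd (n + 3) → Measure (ℕ → Zd (n + 3))}
    (hP : IsSRW (n + 3) P) {x : Zd (n + 3)} {k0 : ℕ} {l0 : ℤ} (hx : x ∈ CklSet (n + 3) L0 k0 l0)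
    (k : ℕ) (l : ℤ) :
    (P x {ω | ∃ m : ℕ, ω m ∈ BklSet (n + 3) L0 k l}).toReal ≤ 6 / (|(k : ℝ) - k0| + 1) := by
  have hLR : (30 : ℝ) ≤ (Lof L0 : ℝ) := by exact_mod_cast hL
  set L : ℝ := (Lof L0 : ℝ) with hLdef
  have hL0 : 0 < L := by linarith
  set h : Zd (n + 3) → ℝ := fun y =>
    2 * L * newton ((k : ℤ) * Lof L0) (l * Mof L0) (L ^ 2) y with hh
  have hnn : ∀ y, 0 ≤ h y := fun y => by simp only [hh, newton]; positivity
  have hone : ∀ y ∈ BklSet (n + 3) L0 k l, 1 ≤ h y := by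
    rintro y ⟨h1, h2, h3, h4, h5⟩
    have h6 := h5 2 (Nat.mod_eq_of_lt (by omega : 2 < n + 3)).ge
    have e0 : coord y 0 = y 0 := by simp [coord]
    have e1 : coord y 1 = y 1 := by simp [coord]
    rw [e0] at h1 h2
    rw [e1] at h3 h4
    have c1 : (k : ℝ) * L ≤ y 0 := by rw [hLdef]; exact_mod_cast h1
    have c2 : (y 0 : ℝ) ≤ k * L + L := by rw [hLdef]; exact_mod_cast h2
    have c3 : (l : ℝ) * Mof L0 ≤ y 1 := by exact_mod_cast h3
    have c4 : (y 1 : ℝ) ≤ l * Mof L0 + L := by rw [hLdef]; exact_mod_cast h4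
    have c5 : (0 : ℝ) ≤ y 2 := by exact_mod_cast h6.1
    have c6 : (y 2 : ℝ) ≤ L := by rw [hLdef]; exact_mod_cast h6.2
    simp only [hh, newton]
    push_cast
    rw [mul_one_div, one_le_div (by positivity)]
    refine Real.sqrt_le_iff.2 ⟨by positivity, ?_⟩
    have d1 : ((y 0 : ℝ) - k * L) ^ 2 ≤ L ^ 2 :=
      pow_le_pow_left₀ (by linarith) (by linarith) 2
    have d2 : ((y 1 : ℝ) - l * Mof L0) ^ 2 ≤ L ^ 2 :=
      pow_le_pow_left₀ (by linarith) (by linarith) 2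
    have d3 : (y 2 : ℝ) ^ 2 ≤ L ^ 2 := pow_le_pow_left₀ c5 c6 2
    nlinarith
  have hsup : ∀ y, ∑ i, (h (y + Pi.single i 1) + h (y - Pi.single i 1))
      ≤ 2 * (n + 3 : ℕ) * h y := fun y => by
    have hs := sum_newton_le ((k : ℤ) * Lof L0) (l * Mof L0)
      (by nlinarith : (30 : ℝ) ≤ L ^ 2) y
    have := mul_le_mul_of_nonneg_left hs (by positivity : 0 ≤ 2 * L)
    rw [Finset.mul_sum] at this
    simp only [hh]
    simp only [mul_add] at this ⊢
    linarith
  refine (IsSRW.hit_le hP (by omega) hnn hone hsup x).trans ?_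
  obtain ⟨-, h1, h2, -, -⟩ := hx
  have e0 : coord x 0 = x 0 := by simp [coord]
  rw [e0] at h1 h2
  have c1 : (k0 : ℝ) * L ≤ x 0 := by rw [hLdef]; exact_mod_cast h1
  have c2 : (x 0 : ℝ) ≤ k0 * L + L := by rw [hLdef]; exact_mod_cast h2
  simp only [hh, newton]
  push_cast
  set D := |(k : ℝ) - k0| with hD
  have hD0 : 0 ≤ D := abs_nonneg _
  have hdist : (D - 1) * L ≤ |(x 0 : ℝ) - k * L| := by
    rw [le_abs]
    rcases abs_cases ((k : ℝ) - k0) with ⟨h, -⟩ | ⟨h, -⟩ <;> rw [← hD] at h <;> rw [h]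
    · right; linarith
    · left; linarith
  have hroot : L * (D + 1) / 3 ≤ √(((x 0 : ℝ) - k * L) ^ 2 + ((x 1 : ℝ) - l * Mof L0) ^ 2
      + (x 2 : ℝ) ^ 2 + L ^ 2) := by
    refine Real.le_sqrt_of_sq_le ?_
    have d2 := sq_nonneg ((x 1 : ℝ) - l * Mof L0)
    have d3 := sq_nonneg (x 2 : ℝ)
    rw [← sq_abs ((x 0 : ℝ) - k * L)]
    rcases le_total D 2 with hD2 | hD2
    · have : (L * (D + 1) / 3) ^ 2 ≤ L ^ 2 :=
        pow_le_pow_left₀ (by positivity) (by nlinarith) 2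
      nlinarith [sq_nonneg |(x 0 : ℝ) - k * L|]
    · have : (L * (D + 1) / 3) ^ 2 ≤ |(x 0 : ℝ) - k * L| ^ 2 :=
        pow_le_pow_left₀ (by positivity) (by nlinarith) 2
      nlinarith [sq_nonneg L]
  calc _ ≤ 2 * L * (1 / (L * (D + 1) / 3)) := by gcongr
    _ = 6 / (D + 1) := by field_simp; norm_num

theorem sum_one_div_dist_le {K k0 : ℕ} (hk0 : k0 < K) :
    ∑ k ∈ Finset.range K, 1 / (|(k : ℝ) - k0| + 1) ≤ 2 * (1 + Real.log K) := by
  set f : ℕ → ℝ := fun j => 1 / ((j : ℝ) + 1) with hf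
  have hf0 : ∀ j, 0 ≤ f j := fun j => by simp only [hf]; positivity
  have hharm : ∑ j ∈ Finset.range K, f j ≤ 1 + Real.log K := by
    have := harmonic_le_one_add_log K
    simpa [harmonic, hf] using this
  have hpre : ∀ m ≤ K, ∑ j ∈ Finset.range m, f j ≤ 1 + Real.log K := fun m hm =>
    (Finset.sum_le_sum_of_subset_of_nonneg (Finset.range_mono hm) fun _ _ _ => hf0 _).trans hharm
  rw [← Finset.sum_range_add_sum_Ico _ (by omega : k0 + 1 ≤ K), two_mul]
  refine add_le_add ?_ ?_
  · rw [← Finset.sum_range_reflect]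
    refine le_trans (Finset.sum_le_sum fun j hj => ?_) (hpre (k0 + 1) hk0)
    have hj' : j ≤ k0 := by simpa [Nat.lt_succ_iff] using hj
    have : ((k0 + 1 - 1 - j : ℕ) : ℝ) = k0 - j := by
      rw [Nat.add_sub_cancel, Nat.cast_sub hj']
    rw [this, sub_sub_cancel_left, abs_neg, Nat.abs_cast]
  · rw [Finset.sum_Ico_eq_sum_range]
    refine le_trans (Finset.sum_le_sum fun j _ => ?_) (hpre (K - (k0 + 1)) (Nat.sub_le _ _))
    simp only [hf]
    have : |((k0 + 1 + j : ℕ) : ℝ) - k0| = j + 1 := by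
      push_cast
      rw [show (k0 : ℝ) + 1 + j - k0 = j + 1 by ring, abs_of_nonneg (by positivity)]
    rw [this]
    gcongr
    linarith

theorem scale_bounds (L0 : ℕ) (h : Real.exp 512 ≤ L0) :
    1 ≤ Mof L0 ∧ 1 ≤ Real.log ((L0 : ℝ) / (Lof L0 : ℝ)) := by
  have hL0 : (0 : ℝ) < L0 := (Real.exp_pos _).trans_le h
  have hlog : 512 ≤ Real.log L0 := (Real.le_log_iff_exp_le hL0).2 h
  set t := Real.log L0 ^ ((1 : ℝ) / 3) with ht
  have ht3 : t ≤ Real.log L0 := by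
    conv_rhs => rw [← Real.rpow_one (Real.log L0)]
    exact Real.rpow_le_rpow_of_exponent_le (by linarith) (by norm_num)
  have ht8 : 8 ≤ t := by
    have : (8 : ℝ) = 512 ^ ((1 : ℝ) / 3) := by
      rw [show (512 : ℝ) = 8 ^ (3 : ℝ) by norm_num, ← Real.rpow_mul (by norm_num)]
      norm_num
    rw [this]
    exact Real.rpow_le_rpow (by norm_num) hlog (by norm_num)
  have hM : 1 ≤ Mof L0 := by
    unfold Mof
    refine Nat.le_floor ?_
    rw [Nat.cast_one, ← ht]
    nth_rewrite 1 [← Real.exp_log hL0]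
    rw [← Real.exp_add]
    exact Real.one_le_exp (by linarith)
  refine ⟨hM, ?_⟩
  have hMle : (Mof L0 : ℝ) ≤ L0 * Real.exp (-t) := Nat.floor_le (by positivity)
  have hM0 : (0 : ℝ) < Mof L0 := by exact_mod_cast hM
  have hLof : (Lof L0 : ℝ) = 1000 * Mof L0 := by simp [Lof]
  rw [Real.le_log_iff_exp_le (by rw [hLof]; positivity), hLof, le_div_iff₀ (by positivity)]
  have h1000 : Real.exp 1 * 1000 ≤ Real.exp t := by
    have h1 : (2.7 : ℝ) ≤ Real.exp 1 := by linarith [Real.exp_one_gt_d9]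
    have h7 : (1000 : ℝ) ≤ Real.exp 1 ^ 7 :=
      le_trans (by norm_num) (pow_le_pow_left₀ (by norm_num) h1 7)
    calc Real.exp 1 * 1000 ≤ Real.exp 1 * Real.exp 1 ^ 7 := by gcongr
      _ = Real.exp 8 := by rw [← pow_succ', ← Real.exp_nat_mul]; norm_num
      _ ≤ Real.exp t := Real.exp_le_exp.2 ht8
  calc Real.exp 1 * (1000 * Mof L0) = Real.exp 1 * 1000 * Mof L0 := by ring
    _ ≤ Real.exp t * (L0 * Real.exp (-t)) := by gcongr
    _ = L0 := by rw [Real.exp_neg]; field_simp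

/-- **Expected number of boxes hit by the walk** ((3.16)).
For all sufficiently large `L₀`, any admissible choice of `(ℓ_k)_{0 ≤ k < K}`, and any
starting point `x` in one of the squares `C_{k,ℓ_k}`:
`Σ_{0 ≤ k < K} P_x[H_{B_{k,ℓ_k}} < ∞] ≤ c log(L₀/L)`. -/
theorem expected_hit_boxes (d : ℕ) (hd : 3 ≤ d) :
    ∃ c : ℝ, 0 < c ∧ ∃ c' : ℝ,
      ∀ L0 : ℕ, c' ≤ (L0 : ℝ) →
        ∀ lk : ℕ → ℤ, (∀ k < Kof L0, |lk k| < (K'of L0 : ℤ)) →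
          ∀ (P : Zd d → Measure (ℕ → Zd d)), IsSRW d P →
            ∀ x : Zd d, (∃ k < Kof L0, x ∈ CklSet d L0 k (lk k)) →
              (∑ k ∈ Finset.range (Kof L0),
                  (P x {ω | ∃ m : ℕ, ω m ∈ BklSet d L0 k (lk k)}).toReal) ≤
                c * Real.log ((L0 : ℝ) / (Lof L0 : ℝ)) := by
  obtain ⟨n, rfl⟩ : ∃ n, d = n + 3 := ⟨d - 3, by omega⟩
  refine ⟨60, by norm_num, Real.exp 512, fun L0 hL0 lk _ P hP x ⟨k0, hk0, hx⟩ => ?_⟩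
  obtain ⟨hM, hlog⟩ := scale_bounds L0 hL0
  have hL : 30 ≤ Lof L0 := by unfold Lof; omega
  have hLR : (0 : ℝ) < (Lof L0 : ℝ) := by exact_mod_cast (by omega : 0 < Lof L0)
  have hL0R : (0 : ℝ) < (L0 : ℝ) := (Real.exp_pos _).trans_le hL0
  calc ∑ k ∈ Finset.range (Kof L0), (P x {ω | ∃ m : ℕ, ω m ∈ BklSet (n + 3) L0 k (lk k)}).toReal
      ≤ ∑ k ∈ Finset.range (Kof L0), 6 * (1 / (|(k : ℝ) - k0| + 1)) :=
        Finset.sum_le_sum fun k _ => by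
          have := hit_box_le hL hP hx k (lk k)
          rw [mul_one_div]; exact this
    _ = 6 * ∑ k ∈ Finset.range (Kof L0), 1 / (|(k : ℝ) - k0| + 1) := by rw [Finset.mul_sum]
    _ ≤ 6 * (2 * (1 + Real.log (Kof L0))) := by
        gcongr
        exact sum_one_div_dist_le hk0
    _ ≤ 60 * Real.log ((L0 : ℝ) / (Lof L0 : ℝ)) := by
        have hK : (Kof L0 : ℝ) ≤ 2 * ((L0 : ℝ) / Lof L0) := by
          unfold Kof
          refine Nat.cast_div_le.trans_eq ?_
          push_cast
          ring
        have hK0 : (0 : ℝ) < (Kof L0 : ℝ) := by exact_mod_cast (by omega : 0 < Kof L0)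
        have h1 := Real.log_le_log hK0 hK
        rw [Real.log_mul (by norm_num) (by positivity)] at h1
        have h2 := Real.log_two_lt_d9
        linarith
end

section
/- Let d ≥ 3. There exist constants c_3 > 0 and c' > 0 depending only on d such that for every integer L_0 ≥ c' and every n ≥ 0, with V and U as below, sup_{x ∈ ℤ^d \ U} P_x[ H_V < ∞ ] ≤ c_3 / ℓ_n^{d−2}. -/
open MeasureTheory Filter

namespace RI

/-- The embedding of `ℤ²` into `ℤ^d`. -/
def embPlane (d : ℕ) (i : ℤ × ℤ) : Zd d :=
  fun j => if (j : ℕ) = 0 then i.1 else if (j : ℕ) = 1 then i.2 else 0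

/-- `V = (([-3Lₙ,3Lₙ]^d + 2Lₙ i₁) ∪ ([-3Lₙ,3Lₙ]^d + 2Lₙ i₂)) ∩ ℤ^d`. -/
def twoBoxV (d : ℕ) (Ln : ℕ) (i1 i2 : ℤ × ℤ) : Set (Zd d) :=
  {x | ∀ j, |x j - 2 * (Ln : ℤ) * embPlane d i1 j| ≤ 3 * (Ln : ℤ)} ∪
  {x | ∀ j, |x j - 2 * (Ln : ℤ) * embPlane d i2 j| ≤ 3 * (Ln : ℤ)}

/-- `U = {z : d(z,V) ≤ L_{n+1}/10}`, the `ℓ^∞`-neighbourhood of `V` of size `L_{n+1}/10`. -/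
def nbhdU (d : ℕ) (L1 : ℕ) (V : Set (Zd d)) : Set (Zd d) :=
  {z | ∃ v ∈ V, ∀ j, 10 * |z j - v j| ≤ (L1 : ℤ)}


end RI

open RI MeasureTheory Filter

/-- Cubic Taylor upper bound for `(1 + t) ^ (-s)` near `t = 0`, with a quartic remainder. -/
theorem exists_one_add_rpow_neg_le (s : ℝ) :
    ∃ δ K a : ℝ, 0 < δ ∧ 0 < K ∧ ∀ t : ℝ, |t| ≤ δ →
      (1 + t) ^ (-s) ≤ 1 - s * t + s * (s + 1) / 2 * t ^ 2 + a * t ^ 3 + K * t ^ 4 := by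
  have h := (Real.one_add_rpow_hasFPowerSeriesAt_zero (a := -s)).isBigO_sub_partialSum_pow 4
  obtain ⟨K, hK, hb⟩ := h.exists_pos
  rw [Asymptotics.IsBigOWith, Metric.eventually_nhds_iff] at hb
  obtain ⟨ε, hε, hb⟩ := hb
  refine ⟨ε / 2, K, Ring.choose (-s) 3, by positivity, hK, fun t ht => ?_⟩
  have hc2 : Ring.choose (-s) 2 = s * (s + 1) / 2 := by
    rw [Ring.choose_eq_smul]
    simp [descPochhammer_succ_right, Polynomial.smeval_mul, Polynomial.smeval_sub]
    ring
  have h1 := hb (y := t) (by rw [Real.dist_eq, sub_zero]; linarith)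
  simp only [zero_add, FormalMultilinearSeries.partialSum, binomialSeries_apply,
    List.ofFn_const, List.prod_replicate, Finset.sum_range_succ, Finset.sum_range_zero,
    Ring.choose_zero_right, Ring.choose_one_right, hc2, smul_eq_mul, norm_pow, Real.norm_eq_abs,
    abs_abs, pow_zero, pow_one] at h1
  have h2 := (abs_le.1 h1).2
  have h3 : |t| ^ 4 = t ^ 4 := by rw [← abs_pow, abs_of_nonneg (by positivity)]
  rw [h3] at h2
  linarith

/-- The two-sided second difference of `v ↦ v ^ (-s)` along a coordinate with value `y`. -/
theorem exists_pair_rpow_neg_le (s : ℝ) :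
    ∃ c M : ℝ, 1 ≤ c ∧ ∀ u y : ℝ, c ≤ u → y ^ 2 ≤ u →
      (u + 1 + 2 * y) ^ (-s) + (u + 1 - 2 * y) ^ (-s) ≤
        u ^ (-s) * (2 - 2 * s / u + (4 * s * (s + 1) * y ^ 2 + M) / u ^ 2) := by
  obtain ⟨δ, K, a, hδ, hK, hT⟩ := exists_one_add_rpow_neg_le s
  set δ' := min δ (1 / 2) with hδ'
  have hδ'0 : 0 < δ' := by positivity
  refine ⟨max 1 (10 / δ' ^ 2), s * (s + 1) + 26 * |a| + 82 * K, le_max_left _ _,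
    fun u y hu hy => ?_⟩
  have hu1 : 1 ≤ u := (le_max_left _ _).trans hu
  have hu0 : 0 < u := by linarith
  have hu10 : 10 ≤ u * δ' ^ 2 := by
    have := (le_max_right _ _).trans hu
    rwa [div_le_iff₀ (by positivity)] at this
  have small (z : ℝ) (hz : z ^ 2 ≤ u) : |(1 + 2 * z) / u| ≤ δ' := by
    apply abs_le_of_sq_le_sq _ hδ'0.le
    rw [div_pow, div_le_iff₀ (by positivity)]
    nlinarith [sq_nonneg (1 - 2 * z)]
  have key (z : ℝ) (hz : z ^ 2 ≤ u) : (u + 1 + 2 * z) ^ (-s) ≤ u ^ (-s) *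
      (1 - s * ((1 + 2 * z) / u) + s * (s + 1) / 2 * ((1 + 2 * z) / u) ^ 2
        + a * ((1 + 2 * z) / u) ^ 3 + K * ((1 + 2 * z) / u) ^ 4) := by
    have hs := small z hz
    have h0 : 0 ≤ 1 + (1 + 2 * z) / u := by
      have := (abs_le.1 hs).1
      have : δ' ≤ 1 / 2 := min_le_right _ _
      linarith
    have : u + 1 + 2 * z = u * (1 + (1 + 2 * z) / u) := by field_simp; ring
    rw [this, Real.mul_rpow hu0.le h0]
    gcongr
    exact hT _ (hs.trans (min_le_left _ _))
  have h1 := key y hy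
  have h2 := key (-y) (by simpa using hy)
  rw [mul_neg, ← sub_eq_add_neg, ← sub_eq_add_neg] at h2
  refine (add_le_add h1 h2).trans ?_
  rw [← mul_add]
  refine mul_le_mul_of_nonneg_left ?_ (Real.rpow_nonneg hu0.le _)
  have hcub : a * (2 + 24 * y ^ 2) / u ^ 3 ≤ 26 * |a| / u ^ 2 := by
    rw [div_le_div_iff₀ (by positivity) (by positivity)]
    have : a * (2 + 24 * y ^ 2) ≤ |a| * (26 * u) :=
      mul_le_mul (le_abs_self a) (by linarith) (by positivity) (abs_nonneg a)
    calc a * (2 + 24 * y ^ 2) * u ^ 2 ≤ |a| * (26 * u) * u ^ 2 := by gcongr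
      _ = _ := by ring
  have hquart : K * (2 + 48 * y ^ 2 + 32 * y ^ 4) / u ^ 4 ≤ 82 * K / u ^ 2 := by
    rw [div_le_div_iff₀ (by positivity) (by positivity)]
    have : 2 + 48 * y ^ 2 + 32 * y ^ 4 ≤ 82 * u ^ 2 := by
      have : y ^ 4 ≤ u ^ 2 := by
        calc y ^ 4 = (y ^ 2) ^ 2 := by ring
          _ ≤ u ^ 2 := by gcongr
      nlinarith
    calc K * (2 + 48 * y ^ 2 + 32 * y ^ 4) * u ^ 2 ≤ K * (82 * u ^ 2) * u ^ 2 := by gcongr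
      _ = _ := by ring
  calc _ = 2 - 2 * s / u + (4 * s * (s + 1) * y ^ 2 + s * (s + 1)) / u ^ 2
        + a * (2 + 24 * y ^ 2) / u ^ 3 + K * (2 + 48 * y ^ 2 + 32 * y ^ 4) / u ^ 4 := by
          field_simp; ring
    _ ≤ 2 - 2 * s / u + (4 * s * (s + 1) * y ^ 2 + s * (s + 1)) / u ^ 2
        + 26 * |a| / u ^ 2 + 82 * K / u ^ 2 := by gcongr
    _ = _ := by ring

namespace RI

/-- A regularisation of the Green function `|x| ^ (2 - d)` on `ℤ^d`. -/
noncomputable def bubble (d : ℕ) (c : ℝ) (x : Zd d) : ℝ :=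
  (∑ i, (x i : ℝ) ^ 2 + c) ^ (-(((d : ℝ) - 2) / 2))

theorem bubble_pos {d : ℕ} {c : ℝ} (hc : 0 < c) (x : Zd d) : 0 < bubble d c x :=
  Real.rpow_pos_of_pos (by positivity) _

theorem sum_sq_add_single {d : ℕ} (x : Zd d) (i : Fin d) (b : ℤ) :
    ∑ j, ((x + Pi.single i b : Zd d) j : ℝ) ^ 2 =
      ∑ j, (x j : ℝ) ^ 2 + 2 * b * x i + (b : ℝ) ^ 2 := by
  have h (j : Fin d) : ((x + Pi.single i b : Zd d) j : ℝ) ^ 2 =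
      (x j : ℝ) ^ 2 + if j = i then 2 * b * x i + (b : ℝ) ^ 2 else 0 := by
    by_cases hj : j = i
    · subst hj
      simp
      ring
    · simp [hj]
  rw [Finset.sum_congr rfl fun j _ => h j, Finset.sum_add_distrib]
  simp [add_assoc]

/-- For `c` large, `bubble d c` is superharmonic on all of `ℤ^d`. -/
theorem exists_bubble_superharmonic (d : ℕ) (hd : 3 ≤ d) :
    ∃ c : ℝ, 1 ≤ c ∧ ∀ x : Zd d,
      ∑ i, (bubble d c (x + Pi.single i 1) + bubble d c (x + Pi.single i (-1))) ≤
        2 * d * bubble d c x := by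
  have hd' : (3 : ℝ) ≤ d := by exact_mod_cast hd
  set s : ℝ := ((d : ℝ) - 2) / 2 with hs
  have hs0 : 0 < s := by rw [hs]; linarith
  obtain ⟨c₀, M, hc₀, hM⟩ := exists_pair_rpow_neg_le s
  refine ⟨max c₀ (M / (2 * s)), hc₀.trans (le_max_left _ _), fun x => ?_⟩
  set c := max c₀ (M / (2 * s)) with hc
  have hcM : M ≤ c * (2 * s) := by
    have : M / (2 * s) ≤ c := le_max_right _ _
    rwa [div_le_iff₀ (by positivity)] at this
  have hcc : c₀ ≤ c := le_max_left _ _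
  set r := ∑ i, (x i : ℝ) ^ 2 with hr
  have hr0 : 0 ≤ r := by positivity
  have hu0 : 0 < r + c := by linarith
  calc ∑ i, (bubble d c (x + Pi.single i 1) + bubble d c (x + Pi.single i (-1)))
      ≤ ∑ i, (r + c) ^ (-s) *
          (2 - 2 * s / (r + c) + (4 * s * (s + 1) * (x i : ℝ) ^ 2 + M) / (r + c) ^ 2) := by
        refine Finset.sum_le_sum fun i _ => ?_
        have hi : (x i : ℝ) ^ 2 ≤ r :=
          Finset.single_le_sum (f := fun i => (x i : ℝ) ^ 2) (fun _ _ => sq_nonneg _)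
            (Finset.mem_univ i)
        have hplus : bubble d c (x + Pi.single i 1) = (r + c + 1 + 2 * x i) ^ (-s) := by
          rw [bubble, sum_sq_add_single]
          congr 1
          push_cast
          ring
        have hminus : bubble d c (x + Pi.single i (-1)) = (r + c + 1 - 2 * x i) ^ (-s) := by
          rw [bubble, sum_sq_add_single]
          congr 1
          push_cast
          ring
        rw [hplus, hminus]
        exact hM (r + c) (x i) (by linarith) (by linarith)
    _ = (r + c) ^ (-s) * (d * 2 - d * (2 * s / (r + c)) +
          (4 * s * (s + 1) * r + d * M) / (r + c) ^ 2) := by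
        rw [← Finset.mul_sum, Finset.sum_add_distrib, ← Finset.sum_div, Finset.sum_add_distrib,
          ← Finset.mul_sum, ← hr]
        simp only [Finset.sum_const, Finset.card_univ, Fintype.card_fin, nsmul_eq_mul, mul_sub]
    _ ≤ (r + c) ^ (-s) * (2 * d) := by
        gcongr
        have : (4 * s * (s + 1) * r + d * M) / (r + c) ^ 2 ≤ d * (2 * s / (r + c)) := by
          rw [← mul_div_assoc (d : ℝ), div_le_div_iff₀ (by positivity) (by positivity)]
          have h1 : 4 * s * (s + 1) = 2 * s * d := by rw [hs]; ring
          have h2 : 2 * s * d * r + d * M ≤ d * (2 * s) * (r + c) := by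
            nlinarith
          rw [h1]
          calc _ ≤ d * (2 * s) * (r + c) * (r + c) := by gcongr
            _ = _ := by ring
        linarith
    _ = 2 * d * bubble d c x := by rw [bubble, mul_comm]

/-- The nearest neighbours of `x` are the points `x ± e_i`. -/
theorem exists_single_of_adj {d : ℕ} {x y : Zd d} (h : adj x y) :
    ∃ i, y = x + Pi.single i 1 ∨ y = x + Pi.single i (-1) := by
  unfold adj at h
  obtain ⟨i, hi⟩ : ∃ i, x i - y i ≠ 0 := by
    by_contra! hne
    simp [hne] at h
  have hsplit := Finset.add_sum_erase Finset.univ (fun j => |x j - y j|) (Finset.mem_univ i)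
  have hpos : 1 ≤ |x i - y i| := Int.one_le_abs hi
  have hnn : ∀ j ∈ Finset.univ.erase i, 0 ≤ |x j - y j| := fun j _ => abs_nonneg _
  have hsum := Finset.sum_nonneg hnn
  have hz : ∑ j ∈ Finset.univ.erase i, |x j - y j| = 0 := by
    omega
  have hi1 : |x i - y i| = 1 := by
    omega
  have hj (j : Fin d) (hne : j ≠ i) : y j = x j := by
    have := (Finset.sum_eq_zero_iff_of_nonneg hnn).1 hz j (by simp [hne])
    rw [abs_eq_zero] at this
    omega
  refine ⟨i, ?_⟩
  rcases (abs_eq (by norm_num)).1 hi1 with h1 | h1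
  · right
    ext j
    by_cases hji : j = i
    · subst hji; simp; omega
    · simp [hji, hj j hji]
  · left
    ext j
    by_cases hji : j = i
    · subst hji; simp; omega
    · simp [hji, hj j hji]

/-- A nonnegative superharmonic function that is at least `1` on `B` bounds the probability that
a walk following a given path up to time `n` visits `B` during the next `N` steps. -/
theorem IsSRW.measure_cylinder_inter_hit_le {d : ℕ} {P : Zd d → Measure (ℕ → Zd d)}
    (hP : IsSRW d P) {H : Zd d → ENNReal} {B : Set (Zd d)} (hB : ∀ y ∈ B, 1 ≤ H y)
    (hH : ∀ y : Zd d,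
      ∑ i, (2 * d : ENNReal)⁻¹ * (H (y + Pi.single i 1) + H (y + Pi.single i (-1))) ≤ H y)
    (x : Zd d) (N : ℕ) : ∀ (n : ℕ) (w : ℕ → Zd d), (w 0 = x ∧ ∀ k < n, adj (w k) (w (k + 1))) →
      P x {ω | (∀ k ≤ n, ω k = w k) ∧ ∃ m, n ≤ m ∧ m ≤ n + N ∧ ω m ∈ B} ≤
        (2 * d : ENNReal)⁻¹ ^ n * H (w n) := by
  have hin : ∀ (N n : ℕ) (w : ℕ → Zd d), (w 0 = x ∧ ∀ k < n, adj (w k) (w (k + 1))) → w n ∈ B →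
      P x {ω | (∀ k ≤ n, ω k = w k) ∧ ∃ m, n ≤ m ∧ m ≤ n + N ∧ ω m ∈ B} ≤
        (2 * d : ENNReal)⁻¹ ^ n * H (w n) := by
    intro N n w hw hwB
    calc _ ≤ P x {ω | ∀ k ≤ n, ω k = w k} := measure_mono fun ω hω => hω.1
      _ = (2 * d : ENNReal)⁻¹ ^ n * 1 := by rw [hP.2.1 x n w hw, mul_one]
      _ ≤ _ := by gcongr; exact hB _ hwB
  induction N with
  | zero =>
    intro n w hw
    by_cases hwB : w n ∈ B
    · exact hin 0 n w hw hwB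
    · have : {ω : ℕ → Zd d | (∀ k ≤ n, ω k = w k) ∧ ∃ m, n ≤ m ∧ m ≤ n + 0 ∧ ω m ∈ B} = ∅ := by
        refine Set.eq_empty_of_forall_notMem ?_
        rintro ω ⟨h1, m, h2, h3, h4⟩
        obtain rfl : m = n := by omega
        exact hwB (h1 m le_rfl ▸ h4)
      rw [this, measure_empty]
      exact zero_le
  | succ N ih =>
    intro n w hw
    by_cases hwB : w n ∈ B
    · exact hin _ n w hw hwB
    let v (y : Zd d) : ℕ → Zd d := Function.update w (n + 1) y
    have hv (y : Zd d) (k : ℕ) (hk : k ≤ n) : v y k = w k :=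
      Function.update_of_ne (by omega) _ _
    have hvn (y : Zd d) : v y (n + 1) = y := Function.update_self _ _ _
    let A (y : Zd d) : Set (ℕ → Zd d) :=
      {ω | (∀ k ≤ n + 1, ω k = v y k) ∧ ∃ m, n + 1 ≤ m ∧ m ≤ n + 1 + N ∧ ω m ∈ B}
    have hA0 (y : Zd d) (hy : ¬ adj (w n) y) : P x (A y) = 0 := by
      have h0 := hP.2.2 x (n + 1) (v y) fun h => hy (by
        have := h.2 n (by omega)
        rwa [hv y n le_rfl, hvn] at this)
      exact measure_mono_null (fun ω hω => hω.1) h0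
    have hA (y : Zd d) : P x (A y) ≤ (2 * d : ENNReal)⁻¹ ^ (n + 1) * H y := by
      by_cases hy : adj (w n) y
      · have := ih (n + 1) (v y) ⟨by rw [hv y 0 (by omega), hw.1], fun k hk => by
          rcases Nat.lt_succ_iff_lt_or_eq.1 hk with hk | rfl
          · rw [hv y k (by omega), hv y (k + 1) (by omega)]
            exact hw.2 k hk
          · rwa [hv y k le_rfl, hvn]⟩
        rwa [hvn] at this
      · rw [hA0 y hy]
        exact zero_le
    have hsub : {ω : ℕ → Zd d | (∀ k ≤ n, ω k = w k) ∧
          ∃ m, n ≤ m ∧ m ≤ n + (N + 1) ∧ ω m ∈ B} ⊆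
        (⋃ y : {y : Zd d // ¬ adj (w n) y}, A y) ∪
          ⋃ i, (A (w n + Pi.single i 1) ∪ A (w n + Pi.single i (-1))) := by
      rintro ω ⟨h1, m, h2, h3, h4⟩
      have hmn : n ≠ m := by
        rintro rfl
        exact hwB (h1 n le_rfl ▸ h4)
      have hω : ω ∈ A (ω (n + 1)) := by
        refine ⟨fun k hk => ?_, m, by omega, by omega, h4⟩
        rcases Nat.le_succ_iff.1 hk with hk | rfl
        · rw [hv _ k hk, h1 k hk]
        · rw [hvn]
      by_cases hadj : adj (w n) (ω (n + 1))
      · obtain ⟨i, hi⟩ := exists_single_of_adj hadj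
        refine Or.inr (Set.mem_iUnion.2 ⟨i, ?_⟩)
        rcases hi with hi | hi
        · exact Or.inl (hi ▸ hω)
        · exact Or.inr (hi ▸ hω)
      · exact Or.inl (Set.mem_iUnion.2 ⟨⟨_, hadj⟩, hω⟩)
    have hnull : P x (⋃ y : {y : Zd d // ¬ adj (w n) y}, A y) = 0 :=
      measure_iUnion_null fun y => hA0 y y.2
    calc _ ≤ P x (⋃ y : {y : Zd d // ¬ adj (w n) y}, A y) +
          P x (⋃ i, (A (w n + Pi.single i 1) ∪ A (w n + Pi.single i (-1)))) :=
          (measure_mono hsub).trans (measure_union_le _ _)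
      _ ≤ ∑ i, P x (A (w n + Pi.single i 1) ∪ A (w n + Pi.single i (-1))) := by
          rw [hnull, zero_add]
          exact measure_iUnion_fintype_le _ _
      _ ≤ ∑ i, ((2 * d : ENNReal)⁻¹ ^ (n + 1) * H (w n + Pi.single i 1) +
            (2 * d : ENNReal)⁻¹ ^ (n + 1) * H (w n + Pi.single i (-1))) := by
          gcongr with i
          exact (measure_union_le _ _).trans (add_le_add (hA _) (hA _))
      _ = (2 * d : ENNReal)⁻¹ ^ n * ∑ i, (2 * d : ENNReal)⁻¹ *
            (H (w n + Pi.single i 1) + H (w n + Pi.single i (-1))) := by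
          rw [Finset.mul_sum]
          refine Finset.sum_congr rfl fun i _ => ?_
          ring
      _ ≤ _ := by gcongr; exact hH _

/-- Hitting probabilities are bounded by superharmonic functions. -/
theorem IsSRW.measure_hit_le {d : ℕ} {P : Zd d → Measure (ℕ → Zd d)}
    (hP : IsSRW d P) {H : Zd d → ENNReal} {B : Set (Zd d)} (hB : ∀ y ∈ B, 1 ≤ H y)
    (hH : ∀ y : Zd d,
      ∑ i, (2 * d : ENNReal)⁻¹ * (H (y + Pi.single i 1) + H (y + Pi.single i (-1))) ≤ H y)
    (x : Zd d) : P x {ω | ∃ m : ℕ, ω m ∈ B} ≤ H x := by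
  have hstart : P x {ω | ω 0 ≠ x} = 0 := by
    have : {ω : ℕ → Zd d | ω 0 ≠ x} ⊆
        ⋃ y : {y : Zd d // y ≠ x}, {ω | ∀ k ≤ 0, ω k = (fun _ => y.1 : ℕ → Zd d) k} := by
      intro ω hω
      refine Set.mem_iUnion.2 ⟨⟨ω 0, hω⟩, fun k hk => ?_⟩
      rw [Nat.le_zero.1 hk]
    refine measure_mono_null this (measure_iUnion_null fun y => ?_)
    exact hP.2.2 x 0 (fun _ => y.1) fun h => y.2 h.1
  have hU : {ω : ℕ → Zd d | ∃ m : ℕ, ω m ∈ B} = ⋃ N : ℕ, {ω | ∃ m ≤ N, ω m ∈ B} := by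
    ext ω
    simp only [Set.mem_ofPred_eq, Set.mem_iUnion]
    exact ⟨fun ⟨m, hm⟩ => ⟨m, m, le_rfl, hm⟩, fun ⟨_, m, _, hm⟩ => ⟨m, hm⟩⟩
  have hmono : Monotone fun N : ℕ => {ω : ℕ → Zd d | ∃ m ≤ N, ω m ∈ B} :=
    fun _ _ hMN ω ⟨m, hm, hmB⟩ => ⟨m, hm.trans hMN, hmB⟩
  rw [hU, hmono.measure_iUnion]
  refine iSup_le fun N => ?_
  have hN := hP.measure_cylinder_inter_hit_le hB hH x N 0 (fun _ => x) (by simp)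
  have hsub : {ω : ℕ → Zd d | ∃ m ≤ N, ω m ∈ B} ⊆ {ω | ω 0 ≠ x} ∪
      {ω | (∀ k ≤ 0, ω k = (fun _ => x : ℕ → Zd d) k) ∧ ∃ m, 0 ≤ m ∧ m ≤ 0 + N ∧ ω m ∈ B} := by
    rintro ω ⟨m, hm, hmB⟩
    by_cases h0 : ω 0 = x
    · exact Or.inr ⟨fun k hk => by rw [Nat.le_zero.1 hk, h0], m, by omega, by omega, hmB⟩
    · exact Or.inl h0
  calc _ ≤ _ := (measure_mono hsub).trans (measure_union_le _ _)
    _ ≤ 0 + _ := add_le_add hstart.le hN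
    _ = H x := by simp

/-- The probability to hit the ball of radius `r` around `z` in the sup-norm, from distance at
least `R`, is at most of order `(r / R) ^ (d - 2)`. -/
theorem exists_measure_hit_box_le (d : ℕ) (hd : 3 ≤ d) :
    ∃ C : ℝ, 0 < C ∧ ∀ P : Zd d → Measure (ℕ → Zd d), IsSRW d P →
      ∀ (z x : Zd d) (r R : ℝ), 1 ≤ r → 0 < R → (∃ j, R ≤ |(x j : ℝ) - z j|) →
        P x {ω | ∃ m : ℕ, ω m ∈ {y : Zd d | ∀ j, |(y j : ℝ) - z j| ≤ r}} ≤
          ENNReal.ofReal (C * (r / R) ^ (d - 2)) := by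
  obtain ⟨c, hc1, hsup⟩ := exists_bubble_superharmonic d hd
  have hd' : (3 : ℝ) ≤ d := by exact_mod_cast hd
  have hc0 : 0 < c := by linarith
  set s : ℝ := ((d : ℝ) - 2) / 2 with hs
  have hs0 : 0 < s := by rw [hs]; linarith
  refine ⟨(d + c) ^ s, by positivity, fun P hP z x r R hr hR ⟨j, hj⟩ => ?_⟩
  set b : ℝ := ((d + c) * r ^ 2) ^ s with hb
  have hb0 : 0 < b := by positivity
  refine (hP.measure_hit_le (H := fun y => ENNReal.ofReal (b * bubble d c (y - z)))
    ?_ ?_ x).trans ?_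
  · intro y hy
    rw [← ENNReal.ofReal_one]
    refine ENNReal.ofReal_le_ofReal ?_
    have hle : ∑ i, ((y - z) i : ℝ) ^ 2 + c ≤ (d + c) * r ^ 2 := by
      have h1 : ∑ i, ((y - z) i : ℝ) ^ 2 ≤ ∑ _i : Fin d, r ^ 2 := by
        refine Finset.sum_le_sum fun i _ => ?_
        rw [Pi.sub_apply, Int.cast_sub]
        exact sq_le_sq' (abs_le.1 (hy i)).1 (abs_le.1 (hy i)).2
      simp only [Finset.sum_const, Finset.card_univ, Fintype.card_fin, nsmul_eq_mul] at h1
      nlinarith [one_le_pow₀ hr (n := 2)]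
    have h2 := Real.rpow_le_rpow_of_nonpos (z := -s) (by positivity) hle (by linarith)
    calc (1 : ℝ) = b * ((d + c) * r ^ 2) ^ (-s) := by
          rw [hb, Real.rpow_neg (by positivity), mul_inv_cancel₀ (by positivity)]
      _ ≤ _ := by rw [bubble]; gcongr
  · intro y
    have hpos := fun v : Zd d => (bubble_pos hc0 v).le
    have h2d : (2 * d : ENNReal)⁻¹ = ENNReal.ofReal (2 * d : ℝ)⁻¹ := by
      rw [ENNReal.ofReal_inv_of_pos (by positivity), ENNReal.ofReal_mul (by norm_num)]
      simp
    simp only [h2d]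
    have hterm (i : Fin d) : ENNReal.ofReal (2 * d : ℝ)⁻¹ *
        (ENNReal.ofReal (b * bubble d c (y + Pi.single i 1 - z)) +
          ENNReal.ofReal (b * bubble d c (y + Pi.single i (-1) - z))) =
        ENNReal.ofReal ((2 * d : ℝ)⁻¹ * b * (bubble d c (y - z + Pi.single i 1) +
          bubble d c (y - z + Pi.single i (-1)))) := by
      rw [← ENNReal.ofReal_add (mul_nonneg hb0.le (hpos _)) (mul_nonneg hb0.le (hpos _)),
        ← ENNReal.ofReal_mul (by positivity), add_sub_right_comm, add_sub_right_comm]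
      congr 1
      ring
    rw [Finset.sum_congr rfl fun i _ => hterm i,
      ← ENNReal.ofReal_sum_of_nonneg fun i _ =>
        mul_nonneg (by positivity) (add_nonneg (hpos _) (hpos _)), ← Finset.mul_sum]
    refine ENNReal.ofReal_le_ofReal ?_
    calc _ ≤ (2 * d : ℝ)⁻¹ * b * (2 * d * bubble d c (y - z)) := by gcongr; exact hsup _
      _ = _ := by field_simp
  · refine ENNReal.ofReal_le_ofReal ?_
    have hle : R ^ 2 ≤ ∑ i, ((x - z) i : ℝ) ^ 2 + c := by
      have h1 : ((x - z) j : ℝ) ^ 2 ≤ ∑ i, ((x - z) i : ℝ) ^ 2 :=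
        Finset.single_le_sum (f := fun i => ((x - z) i : ℝ) ^ 2) (fun _ _ => sq_nonneg _)
          (Finset.mem_univ j)
      have h2 : R ^ 2 ≤ ((x - z) j : ℝ) ^ 2 := by
        rw [Pi.sub_apply, Int.cast_sub, ← sq_abs ((x j : ℝ) - z j)]
        gcongr
      linarith
    have h2 := Real.rpow_le_rpow_of_nonpos (z := -s) (by positivity) hle (by linarith)
    have hpow (v : ℝ) (hv : 0 ≤ v) : (v ^ 2) ^ s = v ^ (d - 2) := by
      rw [← Real.rpow_natCast, ← Real.rpow_natCast, ← Real.rpow_mul hv]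
      congr 1
      rw [Nat.cast_sub (by omega), hs]
      push_cast
      ring
    calc b * bubble d c (x - z) ≤ b * (R ^ 2) ^ (-s) := by rw [bubble]; gcongr
      _ = _ := by
        rw [hb, Real.mul_rpow (by positivity) (by positivity), Real.rpow_neg (by positivity),
          hpow r (by linarith), hpow R hR.le, div_pow]
        ring

theorem one_le_Lseq {L0 : ℕ} (h : 1 ≤ L0) (n : ℕ) : 1 ≤ Lseq L0 n := by
  induction n with
  | zero => exact h
  | succ n ih => exact Nat.mul_pos (Nat.succ_pos _) ih

end RI

/-- **Hitting estimate from outside the neighbourhood** ((2.29)).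
With `V` the union of two boxes of side `6 L_n` centred at `2 L_n i₁` and `2 L_n i₂`
(`|i₁|_∞ = (ℓ_n - 1)/2`, `|i₂|_∞ = ℓ_n`), and `U` its `ℓ^∞`-neighbourhood of size
`L_{n+1}/10`, one has `sup_{x ∉ U} P_x[H_V < ∞] ≤ c₃ / ℓ_n^{d-2}`, provided `L₀ ≥ c'`. -/
theorem hitting_from_outside (d : ℕ) (hd : 3 ≤ d) :
    ∃ c3 c' : ℝ, 0 < c3 ∧ 0 < c' ∧
      ∀ L0 : ℕ, c' ≤ (L0 : ℝ) → ∀ n : ℕ, ∀ i1 i2 : ℤ × ℤ,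
        max |i1.1| |i1.2| = ((ellOf (Lseq L0 n) : ℤ) - 1) / 2 →
        max |i2.1| |i2.2| = (ellOf (Lseq L0 n) : ℤ) →
        ∀ (P : Zd d → Measure (ℕ → Zd d)), IsSRW d P →
          ∀ x : Zd d, x ∉ nbhdU d (Lseq L0 (n + 1)) (twoBoxV d (Lseq L0 n) i1 i2) →
            (P x {ω | ∃ m : ℕ, ω m ∈ twoBoxV d (Lseq L0 n) i1 i2}).toReal ≤
              c3 / (ellOf (Lseq L0 n) : ℝ) ^ (d - 2) := by
  obtain ⟨C, hC, hbox⟩ := exists_measure_hit_box_le d hd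
  refine ⟨2 * (C * 30 ^ (d - 2)), 1, by positivity, one_pos, ?_⟩
  intro L0 hL0 n i1 i2 _ _ P hP x hx
  have hL : 1 ≤ Lseq L0 n := one_le_Lseq (by exact_mod_cast hL0) n
  have hLs : Lseq L0 (n + 1) = ellOf (Lseq L0 n) * Lseq L0 n := rfl
  rw [hLs] at hx
  have hl : 1 ≤ ellOf (Lseq L0 n) := Nat.succ_pos _
  generalize ellOf (Lseq L0 n) = l at *
  generalize Lseq L0 n = L at *
  have hL' : (1 : ℝ) ≤ L := by exact_mod_cast hL
  have hl' : (1 : ℝ) ≤ l := by exact_mod_cast hl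
  have single (p : ℤ × ℤ) (hp : {y : Zd d | ∀ j, |y j - 2 * (L : ℤ) * embPlane d p j| ≤
      3 * (L : ℤ)} ⊆ twoBoxV d L i1 i2) :
      P x {ω | ∃ m : ℕ, ω m ∈ {y : Zd d | ∀ j, |y j - 2 * (L : ℤ) * embPlane d p j| ≤
        3 * (L : ℤ)}} ≤ ENNReal.ofReal (C * 30 ^ (d - 2) / (l : ℝ) ^ (d - 2)) := by
    have hfar : ∃ j, (l * L / 10 : ℝ) ≤
        |(x j : ℝ) - ((fun j => 2 * (L : ℤ) * embPlane d p j : Zd d) j : ℤ)| := by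
      by_contra! hcon
      refine hx ⟨fun j => 2 * (L : ℤ) * embPlane d p j, hp fun j => by simp, fun j => ?_⟩
      have := hcon j
      push_cast at this
      have h2 : (10 * |x j - 2 * (L : ℤ) * embPlane d p j| : ℝ) ≤ l * L := by
        push_cast
        linarith
      exact_mod_cast h2
    have h := hbox P hP _ x (3 * L) (l * L / 10) (by linarith) (by positivity) hfar
    convert h using 2
    · ext ω
      refine exists_congr fun m => forall_congr' fun j => ?_
      rw [← Int.cast_sub, ← Int.cast_abs]
      exact_mod_cast Iff.rfl
    · rw [mul_div_assoc, ← div_pow]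
      congr 2
      field_simp
      norm_num
  have hunion : {ω : ℕ → Zd d | ∃ m : ℕ, ω m ∈ twoBoxV d L i1 i2} ⊆
      {ω | ∃ m : ℕ, ω m ∈ {y : Zd d | ∀ j, |y j - 2 * (L : ℤ) * embPlane d i1 j| ≤
        3 * (L : ℤ)}} ∪
      {ω | ∃ m : ℕ, ω m ∈ {y : Zd d | ∀ j, |y j - 2 * (L : ℤ) * embPlane d i2 j| ≤
        3 * (L : ℤ)}} := by
    rintro ω ⟨m, hm | hm⟩
    · exact Or.inl ⟨m, hm⟩
    · exact Or.inr ⟨m, hm⟩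
  refine ENNReal.toReal_le_of_le_ofReal (by positivity) ?_
  refine (measure_mono hunion).trans ((measure_union_le _ _).trans
    ((add_le_add (single i1 Set.subset_union_left) (single i2 Set.subset_union_right)).trans ?_))
  rw [← ENNReal.ofReal_add (by positivity) (by positivity)]
  exact ENNReal.ofReal_le_ofReal (le_of_eq (by ring))
end
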